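/- Let I be a Cohen-Macaulay R-ideal of positive grade and let e ≥ 1 be an integer. Then the e-th universal link L^e(I) is the unit ideal of R(X) if and only if I can be linked to a complete intersection ideal in e−1 steps. -/

import Mathlib

open RingTheory IsLocalRing

/-- A proper ideal generated by a regular sequence is a complete intersection. -/
def IsCompleteIntersectionIdeal (R : Type) [CommRing R] (I : Ideal R) : Prop :=
  I ≠ ⊤ ∧ ∃ rs : List R, RingTheory.Sequence.IsRegular R rs ∧ Ideal.ofList rs = I

/-- Two proper ideals are directly linked if there is a complete intersection
`c ⊆ I ⊓ J` with `I = c : J` and `J = c : I`. -/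
def IsDirectlyLinked (R : Type) [CommRing R] (I J : Ideal R) : Prop :=
  I ≠ ⊤ ∧ J ≠ ⊤ ∧ ∃ c : Ideal R, IsCompleteIntersectionIdeal R c ∧ c ≤ I ⊓ J ∧
    Submodule.colon c J = I ∧ Submodule.colon c I = J

/-- The linkage (liaison) equivalence: the equivalence relation generated by direct linkage. -/
def InSameLinkageClass (R : Type) [CommRing R] (I J : Ideal R) : Prop :=
  Relation.EqvGen (IsDirectlyLinked R) I J

/-- An ideal is licci if its linkage class contains a complete intersection. -/
def Licci (R : Type) [CommRing R] (I : Ideal R) : Prop :=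
  ∃ J, InSameLinkageClass R I J ∧ IsCompleteIntersectionIdeal R J

open Classical in
/-- `∫ I` : the sum of all ideals in the linkage class of `I` if `I` is not licci,
and the unit ideal otherwise. -/
noncomputable def intLink (R : Type) [CommRing R] (I : Ideal R) : Ideal R :=
  if Licci R I then ⊤ else sSup {J : Ideal R | InSameLinkageClass R I J}

/-- An ideal is maximal in its linkage class if it contains every ideal in its linkage class. -/
def MaximalInLinkageClass (R : Type) [CommRing R] (I : Ideal R) : Prop :=
  ∀ J, InSameLinkageClass R I J → J ≤ I

/-- Linked in `n` steps. -/
def LinkedInSteps (R : Type) [CommRing R] : ℕ → Ideal R → Ideal R → Prop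
  | 0, I, J => I = J
  | (n+1), I, J => ∃ K, IsDirectlyLinked R I K ∧ LinkedInSteps R n K J

/-- The grade of an ideal: the supremum of lengths of regular sequences contained in it. -/
noncomputable def gradeOf (R : Type) [CommRing R] (I : Ideal R) : ℕ :=
  sSup {n : ℕ | ∃ rs : List R, rs.length = n ∧ (∀ r ∈ rs, r ∈ I) ∧
    RingTheory.Sequence.IsRegular R rs}

/-- A Noetherian local ring is Cohen-Macaulay if its depth (the grade of its maximal ideal)
equals its Krull dimension. -/
def IsCMLocalRing (A : Type) [CommRing A] [IsLocalRing A] : Prop :=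
  ringKrullDim A = (gradeOf A (maximalIdeal A) : WithBot (WithTop ℕ))

/-- An ideal `I` of `R` is a Cohen-Macaulay ideal if `R/I` is a Cohen-Macaulay local ring. -/
def IsCMIdeal (R : Type) [CommRing R] (I : Ideal R) : Prop :=
  ∃ h : IsLocalRing (R ⧸ I), @IsCMLocalRing (R ⧸ I) _ h

/-- A Noetherian local ring is Gorenstein if it is Cohen-Macaulay and some ideal generated
by a regular sequence and primary to the maximal ideal is irreducible. -/
def IsGorensteinLocalRing (A : Type) [CommRing A] [IsLocalRing A] : Prop :=
  IsCMLocalRing A ∧ ∃ rs : List A, RingTheory.Sequence.IsRegular A rs ∧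
    (Ideal.ofList rs).radical = maximalIdeal A ∧ InfIrred (Ideal.ofList rs)

open MvPolynomial in
/-- The first generic link `(α₁,…,α_g) : L·B[X]` built from a generating set `f` of `L`,
where `αᵢ = Σⱼ Xⱼᵢ·fⱼ`. -/
noncomputable def genericLinkIdeal {B : Type} [CommRing B] {n : ℕ} (g : ℕ)
    (f : Fin n → B) (L : Ideal B) : Ideal (MvPolynomial (Fin n × Fin g) B) :=
  Submodule.colon
    (Ideal.span (Set.range fun i : Fin g =>
      ∑ j : Fin n, (X (j, i) : MvPolynomial (Fin n × Fin g) B) * C (f j)))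
    (L.map (C : B →+* MvPolynomial (Fin n × Fin g) B))

/-- `IsGenericLinkOf R e I B φ L` says that `L ⊆ B` is an `e`-th generic link of `I`,
obtained by iterating the first generic link construction (with respect to some choice
of finite generating set at each stage); `φ : R →+* B` is the natural inclusion into the
iterated polynomial extension. -/
inductive IsGenericLinkOf (R : Type) [CommRing R] :
    ℕ → Ideal R → (B : CommRingCat.{0}) → (R →+* B) → Ideal B → Prop
  | zero (I : Ideal R) : IsGenericLinkOf R 0 I (CommRingCat.of R) (RingHom.id R) I
  | succ {e : ℕ} {I : Ideal R} {B : CommRingCat.{0}} {φ : R →+* B} {L : Ideal B}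
      (h : IsGenericLinkOf R e I B φ L) (n : ℕ) (f : Fin n → B)
      (hf : Ideal.span (Set.range f) = L) :
      IsGenericLinkOf R (e+1) I
        (CommRingCat.of (MvPolynomial (Fin n × Fin (gradeOf B L)) B))
        ((MvPolynomial.C : B →+* MvPolynomial (Fin n × Fin (gradeOf B L)) B).comp φ)
        (genericLinkIdeal (gradeOf B L) f L)

/-- `IsUniversalLinkOf R e I B φ L` says that `L ⊆ B` is an `e`-th universal link of `I`:
at each stage one passes from the current local ring `B'` to
`B'(X) = B'[X]` localized at the extension of the maximal ideal of `B'`, and extends the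
first generic link there. -/
inductive IsUniversalLinkOf (R : Type) [CommRing R] :
    ℕ → Ideal R → (B : CommRingCat.{0}) → (R →+* B) → Ideal B → Prop
  | zero (I : Ideal R) : IsUniversalLinkOf R 0 I (CommRingCat.of R) (RingHom.id R) I
  | succ {e : ℕ} {I : Ideal R} {B : CommRingCat.{0}} {φ : R →+* B} {L : Ideal B}
      (h : IsUniversalLinkOf R e I B φ L) (hB : IsLocalRing B) (n : ℕ) (f : Fin n → B)
      (hf : Ideal.span (Set.range f) = L)
      (hQ : (((@IsLocalRing.maximalIdeal B _ hB).map
          (MvPolynomial.C : B →+* MvPolynomial (Fin n × Fin (gradeOf B L)) B))).IsPrime) :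
      IsUniversalLinkOf R (e+1) I
        (CommRingCat.of (Localization (@Ideal.primeCompl _ _ _ hQ)))
        ((algebraMap (MvPolynomial (Fin n × Fin (gradeOf B L)) B)
            (Localization (@Ideal.primeCompl _ _ _ hQ))).comp
          ((MvPolynomial.C : B →+* MvPolynomial (Fin n × Fin (gradeOf B L)) B).comp φ))
        ((genericLinkIdeal (gradeOf B L) f L).map
          (algebraMap (MvPolynomial (Fin n × Fin (gradeOf B L)) B)
            (Localization (@Ideal.primeCompl _ _ _ hQ))))

section WeakRegularity

variable {R : Type*} [CommRing R]

/-- The element `r` is a nonzerodivisor modulo the ideal `K`. -/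
def NzdMod (K : Ideal R) (r : R) : Prop := ∀ u, r * u ∈ K → u ∈ K

/-- The list of elements is a weakly regular sequence on `R ⧸ K`. -/
def WeaklyRegularMod : Ideal R → List R → Prop
  | _, [] => True
  | K, r :: rs => NzdMod K r ∧ WeaklyRegularMod (K ⊔ Ideal.span {r}) rs

lemma NzdMod.of_isUnit (K : Ideal R) {r : R} (h : IsUnit r) : NzdMod K r :=
  fun _ hu => (Ideal.unit_mul_mem_iff_mem K h).1 hu

lemma NzdMod.colon {c : Ideal R} {x : R} (h : NzdMod c x) (K : Ideal R) :
    NzdMod (c.colon (K : Set R)) x := by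
  intro u hu
  rw [Submodule.mem_colon] at hu ⊢
  intro s hs
  refine h _ ?_
  have := hu s hs
  simpa [mul_assoc] using this

lemma mem_colon_ideal {c K : Ideal R} {r : R} :
    r ∈ c.colon (K : Set R) ↔ ∀ s ∈ K, r * s ∈ c := by
  simp [Submodule.mem_colon]

lemma weaklyRegularMod_append (K : Ideal R) (xs ys : List R) :
    WeaklyRegularMod K (xs ++ ys) ↔
      WeaklyRegularMod K xs ∧ WeaklyRegularMod (K ⊔ Ideal.ofList xs) ys := by
  induction xs generalizing K with
  | nil => simp [WeaklyRegularMod]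
  | cons x xs ih =>
    simp [WeaklyRegularMod, ih, and_assoc, sup_assoc, Ideal.ofList_cons]

lemma WeaklyRegularMod.take {K : Ideal R} {xs : List R} (h : WeaklyRegularMod K xs) (n : ℕ) :
    WeaklyRegularMod K (xs.take n) := by
  rw [← List.take_append_drop n xs, weaklyRegularMod_append] at h
  exact h.1

lemma weaklyRegularMod_iff_getElem (K : Ideal R) (xs : List R) :
    WeaklyRegularMod K xs ↔
      ∀ i (h : i < xs.length), NzdMod (K ⊔ Ideal.ofList (xs.take i)) xs[i] := by
  induction xs generalizing K with
  | nil => simp [WeaklyRegularMod]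
  | cons x xs ih =>
    rw [WeaklyRegularMod, ih]
    constructor
    · rintro ⟨h1, h2⟩ i hi
      cases i with
      | zero => simpa using h1
      | succ i =>
        have h3 := h2 i (by simpa using hi)
        rw [sup_assoc, ← Ideal.ofList_cons] at h3
        exact h3
    · intro h
      have h0 : NzdMod (K ⊔ Ideal.ofList []) x := h 0 (by simp)
      refine ⟨by simpa using h0, fun i hi => ?_⟩
      have h3 := h (i + 1) (by simpa using hi)
      rw [sup_assoc, ← Ideal.ofList_cons]
      exact h3

lemma isWeaklyRegular_iff_weaklyRegularMod (xs : List R) :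
    Sequence.IsWeaklyRegular R xs ↔ WeaklyRegularMod ⊥ xs := by
  rw [Sequence.isWeaklyRegular_iff, weaklyRegularMod_iff_getElem]
  refine forall₂_congr fun i hi => ?_
  rw [isSMulRegular_quotient_iff_mem_of_smul_mem]
  simp [NzdMod]

lemma isRegular_iff_weaklyRegularMod (xs : List R) :
    Sequence.IsRegular R xs ↔ WeaklyRegularMod ⊥ xs ∧ Ideal.ofList xs ≠ ⊤ := by
  rw [Sequence.isRegular_iff, isWeaklyRegular_iff_weaklyRegularMod]
  simp [eq_comm, ne_eq]

lemma Ideal.comap_sup_span_singleton {S : Type*} [CommRing S] {π : R →+* S}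
    (hπ : Function.Surjective π) (L : Ideal S) (x : R) :
    (L ⊔ Ideal.span {π x}).comap π = L.comap π ⊔ Ideal.span {x} := by
  ext u
  simp only [Ideal.mem_comap, Submodule.mem_sup, Ideal.mem_span_singleton']
  constructor
  · rintro ⟨y, hy, z, ⟨a, rfl⟩, h⟩
    obtain ⟨a, rfl⟩ := hπ a
    refine ⟨u - a * x, ?_, a * x, ⟨a, rfl⟩, by ring⟩
    rw [map_sub, map_mul, ← h]; simpa using hy
  · rintro ⟨y, hy, z, ⟨a, rfl⟩, rfl⟩
    exact ⟨π y, hy, π a * π x, ⟨π a, rfl⟩, by simp⟩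

lemma nzdMod_comap_iff {S : Type*} [CommRing S] {π : R →+* S}
    (hπ : Function.Surjective π) (L : Ideal S) (x : R) :
    NzdMod (L.comap π) x ↔ NzdMod L (π x) := by
  simp [NzdMod, hπ.forall]

lemma weaklyRegularMod_comap_iff {S : Type*} [CommRing S] {π : R →+* S}
    (hπ : Function.Surjective π) (L : Ideal S) (xs : List R) :
    WeaklyRegularMod (L.comap π) xs ↔ WeaklyRegularMod L (xs.map π) := by
  induction xs generalizing L with
  | nil => simp [WeaklyRegularMod]
  | cons x xs ih =>
    simp [WeaklyRegularMod, nzdMod_comap_iff hπ, ← Ideal.comap_sup_span_singleton hπ, ih]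

end WeakRegularity

section Noetherian

variable {R : Type*} [CommRing R] [IsNoetherianRing R]

/-- Simultaneous prime avoidance: an ideal that has no torsion modulo `K` and modulo `K'`
contains an element that is a nonzerodivisor modulo both. -/
lemma exists_nzdMod_of_torsionFree {I K K' : Ideal R}
    (h : ∀ u, (∀ r ∈ I, r * u ∈ K) → u ∈ K) (h' : ∀ u, (∀ r ∈ I, r * u ∈ K') → u ∈ K') :
    ∃ z ∈ I, NzdMod K z ∧ NzdMod K' z := by
  classical
  have key : ∀ (K : Ideal R), (∀ u, (∀ r ∈ I, r * u ∈ K) → u ∈ K) →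
      ∀ p ∈ associatedPrimes R (R ⧸ K), ¬ I ≤ p := by
    intro K h p hp hI
    obtain ⟨hp1, x, hx⟩ := (isAssociatedPrime_iff).1 hp
    obtain ⟨u, rfl⟩ := Ideal.Quotient.mk_surjective x
    have hu : u ∈ K := by
      refine h u fun r hr => ?_
      have h1 := hI hr
      rw [hx, Submodule.mem_colon_singleton, Submodule.mem_bot] at h1
      exact Ideal.Quotient.eq_zero_iff_mem.1 h1
    refine hp1.ne_top (Ideal.eq_top_iff_one _ |>.2 ?_)
    rw [hx, Submodule.mem_colon_singleton, Submodule.mem_bot, one_smul]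
    exact Ideal.Quotient.eq_zero_iff_mem.2 hu
  have nz : ∀ (K : Ideal R) (z : R), (∀ p ∈ associatedPrimes R (R ⧸ K), z ∉ p) → NzdMod K z := by
    intro K z hz u hu
    by_contra hne
    have : z ∈ ⋃ p ∈ associatedPrimes R (R ⧸ K), (p : Set R) := by
      rw [biUnion_associatedPrimes_eq_zero_divisors]
      refine ⟨Ideal.Quotient.mk K u, ?_, ?_⟩
      · rwa [ne_eq, Ideal.Quotient.eq_zero_iff_mem]
      · exact Ideal.Quotient.eq_zero_iff_mem.2 hu
    simp only [Set.mem_iUnion] at this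
    obtain ⟨p, hp, hz'⟩ := this
    exact hz p hp hz'
  have fin : (associatedPrimes R (R ⧸ K) ∪ associatedPrimes R (R ⧸ K')).Finite :=
    (associatedPrimes.finite R _).union (associatedPrimes.finite R _)
  have hnot : ¬ ((I : Set R) ⊆ ⋃ p ∈ fin.toFinset, (p : Set R)) := by
    intro hsub
    have := (Ideal.subset_union_prime (s := fin.toFinset) (f := fun p => p) ⊥ ⊥ (by
      intro p hp _ _
      rw [Set.Finite.mem_toFinset] at hp
      rcases hp with hp | hp
      · exact hp.1
      · exact hp.1)).1 hsub
    obtain ⟨p, hp, hle⟩ := this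
    rw [Set.Finite.mem_toFinset] at hp
    rcases hp with hp | hp
    · exact key K h p hp hle
    · exact key K' h' p hp hle
  obtain ⟨z, hz, hzn⟩ := Set.not_subset.1 hnot
  simp only [Set.Finite.mem_toFinset, Set.mem_iUnion, not_exists] at hzn
  exact ⟨z, hz, nz K z fun p hp hzp => hzn p (Or.inl hp) hzp,
    nz K' z fun p hp hzp => hzn p (Or.inr hp) hzp⟩

end Noetherian

section TorsionFree

variable {R : Type*} [CommRing R]

/-- The ideal `I` has no torsion on `R ⧸ K`. -/
def TorsionFreeMod (I K : Ideal R) : Prop := ∀ u, (∀ r ∈ I, r * u ∈ K) → u ∈ K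

lemma NzdMod.torsionFreeMod {I K : Ideal R} {x : R} (h : NzdMod K x) (hx : x ∈ I) :
    TorsionFreeMod I K := fun u hu => h u (hu x hx)

lemma exists_of_mem_sup_span {K : Ideal R} {x u : R} (h : u ∈ K ⊔ Ideal.span {x}) :
    ∃ v, u - x * v ∈ K := by
  obtain ⟨k, hk, z, hz, rfl⟩ := Submodule.mem_sup.1 h
  obtain ⟨a, rfl⟩ := Ideal.mem_span_singleton'.1 hz
  exact ⟨a, by rwa [mul_comm x a, add_sub_cancel_right]⟩

lemma mem_sup_span_of_sub {K : Ideal R} {x u : R} (v : R) (h : u - x * v ∈ K) :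
    u ∈ K ⊔ Ideal.span {x} :=
  Submodule.mem_sup.2 ⟨_, h, x * v, Ideal.mul_mem_right _ _ (Ideal.mem_span_singleton_self x),
    by ring⟩

lemma mem_sup_span_iff {K : Ideal R} {x u : R} :
    u ∈ K ⊔ Ideal.span {x} ↔ ∃ v, u - x * v ∈ K :=
  ⟨exists_of_mem_sup_span, fun ⟨v, h⟩ => mem_sup_span_of_sub v h⟩

lemma TorsionFreeMod.exchange {I K : Ideal R} {x y : R} (hx : x ∈ I)
    (nx : NzdMod K x) (ny : NzdMod K y) (h : TorsionFreeMod I (K ⊔ Ideal.span {x})) :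
    TorsionFreeMod I (K ⊔ Ideal.span {y}) := by
  intro u hu
  obtain ⟨v, hv⟩ := exists_of_mem_sup_span (hu x hx)
  have hv' : v ∈ K ⊔ Ideal.span {x} := by
    refine h v fun r hr => ?_
    obtain ⟨w, hw⟩ := exists_of_mem_sup_span (hu r hr)
    refine mem_sup_span_of_sub w (ny _ ?_)
    have := sub_mem (K.mul_mem_left x hw) (K.mul_mem_left r hv)
    convert this using 1; ring
  obtain ⟨w, hw⟩ := exists_of_mem_sup_span hv'
  refine mem_sup_span_of_sub w (nx _ ?_)
  have := add_mem hv (K.mul_mem_left y hw)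
  convert this using 1; ring

lemma WeaklyRegularMod.snoc {K : Ideal R} {x : R} {ys : List R}
    (h : WeaklyRegularMod K ys) (hx : NzdMod (K ⊔ Ideal.ofList ys) x) :
    WeaklyRegularMod K (ys ++ [x]) :=
  (weaklyRegularMod_append _ _ _).2 ⟨h, hx, trivial⟩

end TorsionFree

section Local

variable {R : Type*} [CommRing R] [IsLocalRing R]

/-- The socle of `R ⧸ K` is cyclic. -/
def CyclicSocleMod (K : Ideal R) : Prop :=
  ∃ s, (∀ r ∈ maximalIdeal R, r * s ∈ K) ∧
    ∀ u, (∀ r ∈ maximalIdeal R, r * u ∈ K) → u ∈ K ⊔ Ideal.span {s}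

lemma CyclicSocleMod.exchange {K : Ideal R} {x y : R} (hx : x ∈ maximalIdeal R)
    (hy : y ∈ maximalIdeal R) (nx : NzdMod K x) (ny : NzdMod K y)
    (h : CyclicSocleMod (K ⊔ Ideal.span {x})) : CyclicSocleMod (K ⊔ Ideal.span {y}) := by
  obtain ⟨s, hs, hu⟩ := h
  obtain ⟨t, ht⟩ := exists_of_mem_sup_span (hs y hy)
  refine ⟨t, fun r hr => ?_, fun u hu' => ?_⟩
  · obtain ⟨w, hw⟩ := exists_of_mem_sup_span (hs r hr)
    refine mem_sup_span_of_sub w (nx _ ?_)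
    have := sub_mem (K.mul_mem_left y hw) (K.mul_mem_left r ht)
    convert this using 1; ring
  · obtain ⟨v, hv⟩ := exists_of_mem_sup_span (hu' x hx)
    have hv' : ∀ r ∈ maximalIdeal R, r * v ∈ K ⊔ Ideal.span {x} := by
      intro r hr
      obtain ⟨w, hw⟩ := exists_of_mem_sup_span (hu' r hr)
      refine mem_sup_span_of_sub w (ny _ ?_)
      have := sub_mem (K.mul_mem_left x hw) (K.mul_mem_left r hv)
      convert this using 1; ring
    obtain ⟨a, ha⟩ := exists_of_mem_sup_span (hu v hv')
    obtain ⟨w, hw⟩ := exists_of_mem_sup_span ha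
    refine mem_sup_span_of_sub a (mem_sup_span_of_sub w (nx _ ?_))
    have := add_mem (add_mem hv (K.mul_mem_left y hw)) (K.mul_mem_left a ht)
    convert this using 1; ring

lemma cyclicSocleMod_of_infIrred {K : Ideal R} (h : InfIrred K) : CyclicSocleMod K := by
  by_cases hs : ∀ u, (∀ r ∈ maximalIdeal R, r * u ∈ K) → u ∈ K
  · exact ⟨0, by simp, fun u hu => Ideal.mem_sup_left (hs u hu)⟩
  push Not at hs
  obtain ⟨s, hs, hsK⟩ := hs
  refine ⟨s, hs, fun u hu => ?_⟩
  by_contra hne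
  have hinf : (K ⊔ Ideal.span {s}) ⊓ (K ⊔ Ideal.span {u}) = K := by
    refine le_antisymm ?_ (le_inf le_sup_left le_sup_left)
    rintro w ⟨h1, h2⟩
    obtain ⟨a, ha⟩ := exists_of_mem_sup_span h1
    obtain ⟨b, hb⟩ := exists_of_mem_sup_span h2
    by_cases hbu : IsUnit b
    · obtain ⟨b', hb'⟩ := hbu.exists_left_inv
      refine absurd (mem_sup_span_of_sub (a * b') ?_) hne
      have := K.mul_mem_left b' (sub_mem ha hb)
      convert this using 1
      linear_combination (- u) * hb'
    · have := add_mem hb (hu b ((mem_maximalIdeal b).2 hbu))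
      convert this using 1; ring
  rcases h.2 hinf with h1 | h1
  · exact hsK (h1 ▸ mem_sup_span_of_sub 1 (by simp))
  · exact hne (Ideal.mem_sup_left (h1 ▸ mem_sup_span_of_sub 1 (by simp)))

variable [IsNoetherianRing R]

lemma le_of_forall_mem_exists_mul {N K : Ideal R} {x : R} (hx : x ∈ maximalIdeal R)
    (h : ∀ u ∈ N, ∃ v ∈ N, u - x * v ∈ K) : N ≤ K := by
  refine Submodule.le_of_le_smul_of_le_jacobson_bot (I := maximalIdeal R)
    (IsNoetherian.noetherian N) (IsLocalRing.maximalIdeal_le_jacobson _) ?_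
  intro u hu
  obtain ⟨v, hv, h⟩ := h u hu
  exact Submodule.mem_sup.2 ⟨_, h, x * v, Submodule.smul_mem_smul hx hv, by ring⟩

lemma NzdMod.swap {K : Ideal R} {x z : R} (hx : x ∈ maximalIdeal R) (nx : NzdMod K x)
    (nz : NzdMod (K ⊔ Ideal.span {x}) z) : NzdMod K z ∧ NzdMod (K ⊔ Ideal.span {z}) x := by
  have hz : NzdMod K z := by
    have : K.colon {z} ≤ K := by
      refine le_of_forall_mem_exists_mul hx fun u hu => ?_
      rw [Submodule.mem_colon_singleton, smul_eq_mul] at hu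
      obtain ⟨v, hv⟩ := exists_of_mem_sup_span
        (nz u (Ideal.mem_sup_left (by rwa [mul_comm])))
      refine ⟨v, ?_, hv⟩
      rw [Submodule.mem_colon_singleton, smul_eq_mul]
      refine nx _ ?_
      have := sub_mem hu (K.mul_mem_left z hv)
      convert this using 1; ring
    intro u hu
    exact this (by rwa [Submodule.mem_colon_singleton, smul_eq_mul, mul_comm])
  refine ⟨hz, fun u hu => ?_⟩
  obtain ⟨v, hv⟩ := exists_of_mem_sup_span hu
  have hv' : z * v ∈ K ⊔ Ideal.span {x} := by
    refine mem_sup_span_of_sub u ?_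
    convert K.neg_mem hv using 1; ring
  obtain ⟨w, hw⟩ := exists_of_mem_sup_span (nz v hv')
  refine mem_sup_span_of_sub w (nx _ ?_)
  have := add_mem hv (K.mul_mem_left z hw)
  convert this using 1; ring

lemma WeaklyRegularMod.rotate {K : Ideal R} {x : R} (hx : x ∈ maximalIdeal R) {ys : List R}
    (h : WeaklyRegularMod K (x :: ys)) : WeaklyRegularMod K (ys ++ [x]) := by
  induction ys generalizing K with
  | nil => exact h
  | cons y ys ih =>
    obtain ⟨h1, h2, h3⟩ := h
    obtain ⟨h4, h5⟩ := h1.swap hx h2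
    refine ⟨h4, ih ⟨h5, ?_⟩⟩
    rwa [sup_right_comm]

lemma WeaklyRegularMod.unrotate {K : Ideal R} {x : R} {ys : List R}
    (hys : ∀ y ∈ ys, y ∈ maximalIdeal R)
    (h : WeaklyRegularMod K (ys ++ [x])) : WeaklyRegularMod K (x :: ys) := by
  induction ys generalizing K with
  | nil => exact h
  | cons y ys ih =>
    obtain ⟨h1, h2⟩ := h
    obtain ⟨h3, h4⟩ := ih (fun y hy => hys y (List.mem_cons_of_mem _ hy)) h2
    obtain ⟨h5, h6⟩ := h1.swap (hys y List.mem_cons_self) h3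
    refine ⟨h5, h6, ?_⟩
    rwa [sup_right_comm]

/-- A property that is invariant under exchanging one nonzerodivisor is invariant under
exchanging regular sequences of the same length. -/
lemma exchange_regular_sequences {I : Ideal R} (hI : I ≤ maximalIdeal R) (P : Ideal R → Prop)
    (hP : ∀ K x y, x ∈ I → y ∈ I → NzdMod K x → NzdMod K y →
      P (K ⊔ Ideal.span {x}) → P (K ⊔ Ideal.span {y}))
    (n : ℕ) (K : Ideal R) (xs ys : List R) (hxl : xs.length = n) (hyl : ys.length = n)
    (hx : ∀ x ∈ xs, x ∈ I) (hy : ∀ y ∈ ys, y ∈ I) (wx : WeaklyRegularMod K xs)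
    (wy : WeaklyRegularMod K ys) (h : P (K ⊔ Ideal.ofList xs)) : P (K ⊔ Ideal.ofList ys) := by
  induction n generalizing K xs ys with
  | zero =>
    rw [List.length_eq_zero_iff] at hxl hyl
    subst hxl hyl
    exact h
  | succ n ih =>
    obtain rfl | ⟨xs, x, rfl⟩ := xs.eq_nil_or_concat'
    · simp at hxl
    obtain rfl | ⟨ys, y, rfl⟩ := ys.eq_nil_or_concat'
    · simp at hyl
    simp only [List.mem_append, List.mem_singleton, List.length_append, List.length_singleton,
      Nat.add_right_cancel_iff] at hx hy hxl hyl
    rw [weaklyRegularMod_append] at wx wy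
    obtain ⟨z, hz, z1, z2⟩ := exists_nzdMod_of_torsionFree
      (wx.2.1.torsionFreeMod (hx x (Or.inr rfl))) (wy.2.1.torsionFreeMod (hy y (Or.inr rfl)))
    have h1 := hP _ x z (hx x (Or.inr rfl)) hz wx.2.1 z1
      (by simpa [Ideal.ofList_append, sup_assoc] using h)
    have h2 := (wx.1.snoc z1).unrotate fun t ht => hI (hx t (Or.inl ht))
    have h3 := (wy.1.snoc z2).unrotate fun t ht => hI (hy t (Or.inl ht))
    rw [sup_right_comm] at h1
    have h4 := ih _ xs ys hxl hyl (fun t ht => hx t (Or.inl ht)) (fun t ht => hy t (Or.inl ht))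
      h2.2 h3.2 h1
    rw [sup_right_comm] at h4
    have h5 := hP _ z y hz (hy y (Or.inr rfl)) z2 wy.2.1 h4
    simpa [Ideal.ofList_append, sup_assoc] using h5

lemma CyclicSocleMod.of_regular {K : Ideal R} {xs ys : List R} (hl : ys.length = xs.length)
    (hx : ∀ x ∈ xs, x ∈ maximalIdeal R) (hy : ∀ y ∈ ys, y ∈ maximalIdeal R)
    (wx : WeaklyRegularMod K xs) (wy : WeaklyRegularMod K ys)
    (h : CyclicSocleMod (K ⊔ Ideal.ofList xs)) : CyclicSocleMod (K ⊔ Ideal.ofList ys) :=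
  exchange_regular_sequences le_rfl CyclicSocleMod
    (fun _ _ _ hx hy nx ny h => h.exchange hx hy nx ny) _ K xs ys rfl hl hx hy wx wy h

lemma WeaklyRegularMod.exists_snoc {I : Ideal R} (hI : I ≤ maximalIdeal R) {K : Ideal R}
    {xs zs : List R} (hl : zs.length < xs.length) (hx : ∀ x ∈ xs, x ∈ I) (hz : ∀ z ∈ zs, z ∈ I)
    (wx : WeaklyRegularMod K xs) (wz : WeaklyRegularMod K zs) :
    ∃ y ∈ I, WeaklyRegularMod K (zs ++ [y]) := by
  have h1 := (weaklyRegularMod_iff_getElem K xs).1 wx _ hl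
  have h2 : TorsionFreeMod I (K ⊔ Ideal.ofList zs) :=
    exchange_regular_sequences hI (TorsionFreeMod I)
      (fun _ _ _ hx _ nx ny h => h.exchange hx nx ny) zs.length K (xs.take zs.length) zs
      (by simpa using hl.le) rfl (fun x hx' => hx x (List.mem_of_mem_take hx')) hz
      (wx.take _) wz (h1.torsionFreeMod (hx _ (List.getElem_mem hl)))
  obtain ⟨y, hy, ny, -⟩ := exists_nzdMod_of_torsionFree h2 h2
  exact ⟨y, hy, wz.snoc ny⟩

lemma WeaklyRegularMod.exists_append {I : Ideal R} (hI : I ≤ maximalIdeal R) {K : Ideal R}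
    {xs : List R} (n : ℕ) {zs : List R} (hl : zs.length + n = xs.length)
    (hx : ∀ x ∈ xs, x ∈ I) (hz : ∀ z ∈ zs, z ∈ I)
    (wx : WeaklyRegularMod K xs) (wz : WeaklyRegularMod K zs) :
    ∃ ys : List R, ys.length = n ∧ (∀ y ∈ ys, y ∈ I) ∧ WeaklyRegularMod K (zs ++ ys) := by
  induction n generalizing zs with
  | zero => exact ⟨[], rfl, by simp, by simpa using wz⟩
  | succ n ih =>
    obtain ⟨y, hy, h⟩ := WeaklyRegularMod.exists_snoc hI (by omega) hx hz wx wz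
    obtain ⟨ys, h1, h2, h3⟩ := ih (zs := zs ++ [y]) (by simp; omega)
      (by simpa [or_imp, forall_and] using ⟨hz, hy⟩) h
    exact ⟨y :: ys, by simp [h1], by simpa using ⟨hy, h2⟩, by simpa using h3⟩

/-- There is a weakly regular sequence of length `n` on `R ⧸ K` inside `I`. -/
def HasRegularSeq (I K : Ideal R) (n : ℕ) : Prop :=
  ∃ xs : List R, xs.length = n ∧ (∀ x ∈ xs, x ∈ I) ∧ WeaklyRegularMod K xs

lemma HasRegularSeq.sup_ofList {I K : Ideal R} (hI : I ≤ maximalIdeal R) {n : ℕ} {zs : List R}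
    (h : HasRegularSeq I K (zs.length + n)) (hz : ∀ z ∈ zs, z ∈ I) (wz : WeaklyRegularMod K zs) :
    HasRegularSeq I (K ⊔ Ideal.ofList zs) n := by
  obtain ⟨xs, h1, h2, h3⟩ := h
  obtain ⟨ys, h4, h5, h6⟩ := WeaklyRegularMod.exists_append hI n h1.symm h2 hz h3 wz
  exact ⟨ys, h4, h5, ((weaklyRegularMod_append _ _ _).1 h6).2⟩

lemma HasRegularSeq.sup_span {I K : Ideal R} (hI : I ≤ maximalIdeal R) {n : ℕ} {z : R}
    (h : HasRegularSeq I K (n + 1)) (hz : z ∈ I) (nz : NzdMod K z) :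
    HasRegularSeq I (K ⊔ Ideal.span {z}) n := by
  simpa using HasRegularSeq.sup_ofList (zs := [z]) (n := n) hI
    (by simpa [add_comm] using h) (by simpa using hz) ⟨nz, trivial⟩

lemma exists_common_regularSeq {I : Ideal R} (hI : I ≤ maximalIdeal R) {K K' : Ideal R} {n : ℕ}
    (h : HasRegularSeq I K n) (h' : HasRegularSeq I K' n) :
    ∃ zs : List R, zs.length = n ∧ (∀ z ∈ zs, z ∈ I) ∧ WeaklyRegularMod K zs ∧
      WeaklyRegularMod K' zs := by
  induction n generalizing K K' with
  | zero => exact ⟨[], rfl, by simp, trivial, trivial⟩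
  | succ n ih =>
    obtain ⟨z, hz, z1, z2⟩ : ∃ z ∈ I, NzdMod K z ∧ NzdMod K' z := by
      obtain ⟨xs, h1, h2, h3⟩ := h
      obtain ⟨ys, h4, h5, h6⟩ := h'
      obtain ⟨x, xs, rfl⟩ := List.exists_cons_of_length_eq_add_one h1
      obtain ⟨y, ys, rfl⟩ := List.exists_cons_of_length_eq_add_one h4
      exact exists_nzdMod_of_torsionFree (h3.1.torsionFreeMod (h2 x List.mem_cons_self))
        (h6.1.torsionFreeMod (h5 y List.mem_cons_self))
    obtain ⟨zs, h1, h2, h3, h4⟩ := ih (h.sup_span hI hz z1) (h'.sup_span hI hz z2)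
    exact ⟨z :: zs, by simp [h1], by simpa using ⟨hz, h2⟩, ⟨z1, h3⟩, ⟨z2, h4⟩⟩

/-- The dimension of `R ⧸ J` is bounded below by the depth of `R ⧸ c` if `J` annihilates a nonzero
element of `R ⧸ c`. -/
lemma length_le_ringKrullDim_of_annihilates {c J : Ideal R} {ys : List R}
    (hy : ∀ y ∈ ys, y ∈ maximalIdeal R) (wy : WeaklyRegularMod c ys) {u : R} (hu : u ∉ c)
    (hJ : ∀ j ∈ J, j * u ∈ c) : (ys.length : WithBot ℕ∞) ≤ ringKrullDim (R ⧸ J) := by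
  induction ys generalizing c J u with
  | nil =>
    have : J ≠ ⊤ := by
      rintro rfl
      exact hu (by simpa using hJ 1 trivial)
    have := Ideal.Quotient.nontrivial_iff.2 this
    simpa using ringKrullDim_nonneg_of_nontrivial
  | cons y ys ih =>
    obtain ⟨p, hp, hle⟩ := exists_le_isAssociatedPrime_of_isNoetherianRing R
      (Ideal.Quotient.mk c u) (by rwa [ne_eq, Ideal.Quotient.eq_zero_iff_mem])
    obtain ⟨hp1, v, hv⟩ := isAssociatedPrime_iff.1 hp
    obtain ⟨v, rfl⟩ := Ideal.Quotient.mk_surjective v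
    have hmem : ∀ r, r ∈ p ↔ r * v ∈ c := by
      intro r
      rw [hv, Submodule.mem_colon_singleton, Submodule.mem_bot]
      exact Ideal.Quotient.eq_zero_iff_mem
    have hJp : J ≤ p := by
      intro r hr
      refine hle ?_
      rw [Submodule.mem_colon_singleton, Submodule.mem_bot]
      exact Ideal.Quotient.eq_zero_iff_mem.2 (hJ r hr)
    have hvc : v ∉ c := fun h => hp1.ne_top
      ((Ideal.eq_top_iff_one _).2 ((hmem 1).2 (by simpa using h)))
    have hyp : y ∉ p := fun h => hvc (wy.1 v ((hmem y).1 h))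
    have hym := hy y List.mem_cons_self
    obtain ⟨w, hw1, hw2⟩ : ∃ w ∈ c.colon (p : Set R), w ∉ c ⊔ Ideal.span {y} := by
      by_contra! hcon
      have : c.colon (p : Set R) ≤ c := by
        refine le_of_forall_mem_exists_mul hym fun a ha => ?_
        obtain ⟨b, hb⟩ := exists_of_mem_sup_span (hcon a ha)
        refine ⟨b, ?_, hb⟩
        rw [mem_colon_ideal] at ha ⊢
        intro s hs
        refine wy.1 _ ?_
        have := sub_mem (ha s hs) (c.mul_mem_right s hb)
        convert this using 1; ring
      refine hvc (this (mem_colon_ideal.2 fun s hs => ?_))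
      rw [mul_comm]
      exact (hmem s).1 hs
    rw [mem_colon_ideal] at hw1
    have h1 := ih (J := p ⊔ Ideal.span {y}) (fun z hz => hy z (List.mem_cons_of_mem _ hz)) wy.2 hw2
      (by
        intro j hj
        obtain ⟨b, hb⟩ := exists_of_mem_sup_span hj
        refine mem_sup_span_of_sub (b * w) ?_
        convert hw1 _ hb using 1; ring)
    have h2 : ringKrullDim (R ⧸ (p ⊔ Ideal.span {y})) + 1 ≤ ringKrullDim (R ⧸ p) := by
      refine ringKrullDim_succ_le_of_surjective (Ideal.Quotient.factor le_sup_left)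
        (Ideal.Quotient.factor_surjective _) (r := Ideal.Quotient.mk p y) ?_ ?_
      · rw [mem_nonZeroDivisors_iff_ne_zero, ne_eq, Ideal.Quotient.eq_zero_iff_mem]
        exact hyp
      · rw [Ideal.Quotient.factor_mk, Ideal.Quotient.eq_zero_iff_mem]
        exact Ideal.mem_sup_right (Ideal.mem_span_singleton_self y)
    have h3 : ringKrullDim (R ⧸ p) ≤ ringKrullDim (R ⧸ J) :=
      ringKrullDim_le_of_surjective (Ideal.Quotient.factor hJp)
        (Ideal.Quotient.factor_surjective _)
    refine le_trans ?_ (h2.trans h3)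
    rw [List.length_cons]
    push_cast
    gcongr

end Local

section Length

variable {R : Type*} [CommRing R]

lemma length_quotient_add_one_le {A B : Ideal R} (h : A < B) :
    Module.length R (R ⧸ B) + 1 ≤ Module.length R (R ⧸ A) := by
  let π : (R ⧸ A) →ₗ[R] (R ⧸ B) := Submodule.factor h.le
  have hπ : Function.Surjective π := Submodule.factor_surjective h.le
  rw [Module.length_eq_add_of_exact (LinearMap.ker π).subtype π (Submodule.subtype_injective _) hπ
    (by rw [LinearMap.exact_iff]; simp), add_comm]
  gcongr
  rw [Order.one_le_iff_pos, Module.length_pos_iff, Submodule.nontrivial_iff_ne_bot]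
  intro hbot
  obtain ⟨b, hb, hbA⟩ := Set.exists_of_ssubset h
  refine hbA ?_
  have : Submodule.Quotient.mk b ∈ LinearMap.ker π := by
    rw [LinearMap.mem_ker]
    exact (Submodule.Quotient.mk_eq_zero _).2 hb
  rw [hbot, Submodule.mem_bot] at this
  exact (Submodule.Quotient.mk_eq_zero _).1 this

lemma length_quotient_le_add_one [IsLocalRing R] {A B : Ideal R} (hAB : A ≤ B) (b : R)
    (hb : B ≤ A ⊔ Ideal.span {b}) (hm : ∀ r ∈ maximalIdeal R, r * b ∈ A) :
    Module.length R (R ⧸ A) ≤ Module.length R (R ⧸ B) + 1 := by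
  let π : (R ⧸ A) →ₗ[R] (R ⧸ B) := Submodule.factor hAB
  have hπ : Function.Surjective π := Submodule.factor_surjective hAB
  rw [Module.length_eq_add_of_exact (LinearMap.ker π).subtype π (Submodule.subtype_injective _) hπ
    (by rw [LinearMap.exact_iff]; simp), add_comm]
  gcongr
  let j : (R ⧸ maximalIdeal R) →ₗ[R] (R ⧸ A) :=
    Submodule.liftQ _ ((LinearMap.toSpanSingleton R (R ⧸ A) (Submodule.Quotient.mk b))) (by
      intro r hr
      rw [LinearMap.mem_ker, LinearMap.toSpanSingleton_apply, ← Submodule.Quotient.mk_smul]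
      exact (Submodule.Quotient.mk_eq_zero _).2 (hm r hr))
  have hle : LinearMap.ker π ≤ LinearMap.range j := by
    intro x hx
    obtain ⟨u, rfl⟩ := Submodule.Quotient.mk_surjective _ x
    have hu : u ∈ B := (Submodule.Quotient.mk_eq_zero _).1 hx
    obtain ⟨v, hv⟩ := exists_of_mem_sup_span (hb hu)
    refine ⟨Submodule.Quotient.mk v, ?_⟩
    refine (Submodule.liftQ_apply _ _ _).trans ?_
    rw [LinearMap.toSpanSingleton_apply, ← Submodule.Quotient.mk_smul]
    refine ((Submodule.Quotient.eq _).2 ?_).symm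
    rwa [smul_eq_mul, mul_comm]
  have : IsSimpleModule R (R ⧸ maximalIdeal R) :=
    isSimpleModule_iff_isCoatom.2 (IsLocalRing.maximalIdeal.isMaximal R).1
  calc Module.length R (LinearMap.ker π) ≤ Module.length R (LinearMap.range j) :=
        Module.length_le_of_injective (Submodule.inclusion hle) (Submodule.inclusion_injective hle)
    _ ≤ Module.length R (R ⧸ maximalIdeal R) :=
        Module.length_le_of_surjective j.rangeRestrict j.surjective_rangeRestrict
    _ = 1 := Module.length_eq_one R _

lemma length_colon_le [IsLocalRing R] {q K : Ideal R} (hq : CyclicSocleMod q) {u : R}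
    (hu : ∀ s ∈ maximalIdeal R, s * u ∈ K) :
    Module.length R (R ⧸ q.colon ((K ⊔ Ideal.span {u} : Ideal R) : Set R)) ≤
      Module.length R (R ⧸ q.colon (K : Set R)) + 1 := by
  obtain ⟨s, hs, hs'⟩ := hq
  have hle : q.colon ((K ⊔ Ideal.span {u} : Ideal R) : Set R) ≤ q.colon (K : Set R) :=
    Submodule.colon_mono le_rfl (le_sup_left (a := K))
  have hmem : ∀ a ∈ q.colon (K : Set R), a * u ∈ q →
      a ∈ q.colon ((K ⊔ Ideal.span {u} : Ideal R) : Set R) := by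
    intro a ha hau
    rw [mem_colon_ideal] at ha ⊢
    intro t ht
    obtain ⟨v, hv⟩ := exists_of_mem_sup_span ht
    have := add_mem (ha _ hv) (q.mul_mem_right v hau)
    convert this using 1; ring
  have hex : ∀ a ∈ q.colon (K : Set R), ∃ α, a * u - s * α ∈ q := by
    intro a ha
    refine exists_of_mem_sup_span (hs' _ fun r hr => ?_)
    have := mem_colon_ideal.1 ha _ (hu r hr)
    convert this using 1; ring
  by_cases hall : ∀ a ∈ q.colon (K : Set R), a * u ∈ q
  · rw [le_antisymm hle fun a ha => hmem a ha (hall a ha)]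
    exact le_self_add
  push Not at hall
  obtain ⟨b, hb, hbu⟩ := hall
  obtain ⟨β, hβ⟩ := hex b hb
  have hβu : IsUnit β := by
    by_contra hn
    have := add_mem hβ (hs β ((mem_maximalIdeal _).2 hn))
    exact hbu (by convert this using 1; ring)
  obtain ⟨β', hβ'⟩ := hβu.exists_left_inv
  refine length_quotient_le_add_one hle b (fun a ha => ?_) fun r hr => ?_
  · obtain ⟨α, hα⟩ := hex a ha
    refine mem_sup_span_of_sub (α * β') (hmem _ (sub_mem ha (Ideal.mul_mem_right _ _ hb)) ?_)
    have := sub_mem hα (q.mul_mem_left (α * β') hβ)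
    convert this using 1
    linear_combination (- s * α) * hβ'
  · refine hmem _ (Ideal.mul_mem_left _ _ hb) ?_
    have := add_mem (q.mul_mem_left r hβ) (q.mul_mem_left β (hs r hr))
    convert this using 1; ring

end Length

section Colon

variable {R : Type*} [CommRing R]

lemma colon_self (q : Ideal R) : q.colon (q : Set R) = ⊤ :=
  (Ideal.eq_top_iff_one _).2 (mem_colon_ideal.2 fun s hs => by simpa using hs)

lemma colon_top (q : Ideal R) : q.colon ((⊤ : Ideal R) : Set R) = q :=
  le_antisymm (fun u hu => by simpa using mem_colon_ideal.1 hu 1 trivial)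
    fun u hu => mem_colon_ideal.2 fun s _ => q.mul_mem_right s hu

lemma le_colon_colon (q K : Ideal R) :
    K ≤ q.colon (q.colon (K : Set R) : Set R) := fun k hk =>
  mem_colon_ideal.2 fun s hs => by rw [mul_comm]; exact mem_colon_ideal.1 hs k hk

lemma colon_colon_colon (q K : Ideal R) :
    q.colon (q.colon (q.colon (K : Set R) : Set R) : Set R) = q.colon (K : Set R) :=
  le_antisymm (Submodule.colon_mono le_rfl (le_colon_colon q K)) (le_colon_colon _ _)

lemma le_colon (q K : Ideal R) : q ≤ q.colon (K : Set R) :=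
  fun _ hu => mem_colon_ideal.2 fun s _ => q.mul_mem_right s hu

end Colon

section DoubleAnnihilator

variable {R : Type*} [CommRing R] [IsLocalRing R] [IsNoetherianRing R]

/-- The quotient `R ⧸ q` is Artinian with cyclic socle. -/
def QuasiFrobeniusMod (q : Ideal R) : Prop :=
  maximalIdeal R ≤ q.radical ∧ CyclicSocleMod q

lemma exists_socle_element {q K : Ideal R} (hq : maximalIdeal R ≤ q.radical) (hK : q ≤ K) {v : R}
    (hv : v ∉ K) : ∃ r, r * v ∉ K ∧ ∀ s ∈ maximalIdeal R, s * (r * v) ∈ K := by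
  obtain ⟨k, hk⟩ := Ideal.exists_pow_le_of_le_radical_of_fg hq (IsNoetherian.noetherian _)
  have : ∀ s ∈ maximalIdeal R ^ k, s * v ∈ K := fun s hs => K.mul_mem_right _ (hK (hk hs))
  clear hk
  induction k generalizing v with
  | zero => exact absurd (by simpa using this 1 (by simp)) hv
  | succ k ih =>
    by_cases h : ∀ r ∈ maximalIdeal R, r * v ∈ K
    · exact ⟨1, by simpa using hv, by simpa using h⟩
    push Not at h
    obtain ⟨r, hr, hrv⟩ := h
    obtain ⟨t, ht, ht'⟩ := ih hrv (fun s hs => by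
      rw [← mul_assoc]
      exact this _ (by rw [pow_succ]; exact Ideal.mul_mem_mul hs hr))
    refine ⟨t * r, by rwa [mul_assoc], fun s hs => ?_⟩
    rw [mul_assoc]; exact ht' s hs

lemma exists_socle_between {q K K' : Ideal R} (hq : maximalIdeal R ≤ q.radical) (hK : q ≤ K)
    (h : K < K') : ∃ u ∈ K', u ∉ K ∧ ∀ s ∈ maximalIdeal R, s * u ∈ K := by
  obtain ⟨v, hv, hvK⟩ := Set.exists_of_ssubset h
  obtain ⟨r, h1, h2⟩ := exists_socle_element hq hK hvK
  exact ⟨r * v, K'.mul_mem_left _ hv, h1, h2⟩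

lemma length_colon_add_length_mono {q : Ideal R} (hq : QuasiFrobeniusMod q) {K K' : Ideal R}
    (hqK : q ≤ K) (h : K ≤ K') :
    Module.length R (R ⧸ q.colon (K' : Set R)) + Module.length R (R ⧸ K') ≤
      Module.length R (R ⧸ q.colon (K : Set R)) + Module.length R (R ⧸ K) := by
  induction K using IsNoetherian.induction with
  | hgt K ih =>
    obtain rfl | hlt := h.eq_or_lt
    · rfl
    obtain ⟨u, hu, huK, hum⟩ := exists_socle_between hq.1 hqK hlt
    have hK1 : K < K ⊔ Ideal.span {u} := by simpa [Ideal.span_singleton_le_iff_mem] using huK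
    refine (ih _ hK1 (hqK.trans hK1.le)
      (sup_le h ((Ideal.span_singleton_le_iff_mem _).2 hu))).trans ?_
    calc _ ≤ (Module.length R (R ⧸ q.colon (K : Set R)) + 1)
          + Module.length R (R ⧸ (K ⊔ Ideal.span {u})) := by
            gcongr
            exact length_colon_le hq.2 hum
      _ ≤ _ := by
        rw [add_right_comm, add_assoc]
        gcongr
        exact length_quotient_add_one_le hK1

lemma length_quotient_ne_top {q : Ideal R} (hq : maximalIdeal R ≤ q.radical) {K : Ideal R}
    (hqK : q ≤ K) : Module.length R (R ⧸ K) ≠ ⊤ := by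
  induction K using IsNoetherian.induction with
  | hgt K ih =>
    obtain rfl | hlt := (le_top : K ≤ ⊤).eq_or_lt
    · have : Subsingleton (R ⧸ (⊤ : Ideal R)) := Ideal.Quotient.subsingleton_iff.2 rfl
      rw [Module.length_eq_zero]; simp
    obtain ⟨u, hu, huK, hum⟩ := exists_socle_between hq hqK hlt
    have hK1 : K < K ⊔ Ideal.span {u} := by simpa [Ideal.span_singleton_le_iff_mem] using huK
    have h1 := ih _ hK1 (hqK.trans hK1.le)
    have h2 := length_quotient_le_add_one hK1.le u le_rfl hum
    exact ne_top_of_le_ne_top (by simpa using h1) h2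

lemma QuasiFrobeniusMod.colon_colon {q : Ideal R} (hq : QuasiFrobeniusMod q) {K : Ideal R}
    (hqK : q ≤ K) : q.colon (q.colon (K : Set R) : Set R) = K := by
  have key : ∀ K : Ideal R, q ≤ K → Module.length R (R ⧸ q.colon (K : Set R)) +
      Module.length R (R ⧸ K) = Module.length R (R ⧸ q) := by
    intro K hK
    have htop : Module.length R (R ⧸ (⊤ : Ideal R)) = 0 := by
      have : Subsingleton (R ⧸ (⊤ : Ideal R)) := Ideal.Quotient.subsingleton_iff.2 rfl
      rw [Module.length_eq_zero]
    refine le_antisymm ?_ ?_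
    · simpa [colon_self, htop] using length_colon_add_length_mono hq le_rfl hK
    · have h := length_colon_add_length_mono hq hK le_top
      rwa [colon_top, htop, add_zero] at h
  by_contra hne
  have hlt := (le_colon_colon q K).lt_of_ne (Ne.symm hne)
  have h1 := key K hqK
  have h2 := key _ (hqK.trans hlt.le)
  rw [colon_colon_colon] at h2
  have hfin := length_quotient_ne_top hq.1 (le_colon q K)
  have h3 := ENat.add_right_injective_of_ne_top hfin (h1.trans h2.symm)
  have h4 := length_quotient_add_one_le hlt
  rw [← show Module.length R (R ⧸ K) = _ from h3] at h4
  exact ((ENat.add_one_le_iff (length_quotient_ne_top hq.1 hqK)).1 h4).false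

/-- Every `R`-linear map from the ideal generated by `f` to `R ⧸ c`, vanishing on the intersection
with `c`, is multiplication by an element. -/
def ExtensionProperty {R : Type*} [CommRing R] (c : Ideal R) {n : ℕ} (f : Fin n → R) : Prop :=
  ∀ y : Fin n → R, (∀ r : Fin n → R, ∑ i, r i * f i ∈ c → ∑ i, r i * y i ∈ c) →
    ∃ a, ∀ i, y i - a * f i ∈ c

lemma QuasiFrobeniusMod.extensionProperty {q : Ideal R} (hq : QuasiFrobeniusMod q) {n : ℕ}
    (f : Fin n → R) : ExtensionProperty q f := by
  induction n with
  | zero => exact fun _ _ => ⟨0, fun i => i.elim0⟩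
  | succ n ih =>
    intro y hy
    obtain ⟨a, ha⟩ := ih (fun i => f i.castSucc) (fun i => y i.castSucc) (by
      intro r hr
      have := hy (Fin.snoc r 0) (by simpa [Fin.sum_univ_castSucc] using hr)
      simpa [Fin.sum_univ_castSucc] using this)
    set K1 := q ⊔ Ideal.span (Set.range fun i : Fin n => f i.castSucc) with hK1
    set N := q.colon (K1 : Set R) * Ideal.span {f (Fin.last n)} ⊔ q with hN
    set v := y (Fin.last n) - a * f (Fin.last n) with hv
    have hcol : ∀ r, r * f (Fin.last n) ∈ K1 → r * v ∈ q := by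
      intro r hr
      obtain ⟨k, hk, z, hz, hkz⟩ := Submodule.mem_sup.1 hr
      obtain ⟨b, rfl⟩ := (Ideal.mem_span_range_iff_exists_fun).1 hz
      have h1 := hy (Fin.snoc (fun i => - b i) r) (by
        rw [Fin.sum_univ_castSucc]
        simp only [Fin.snoc_castSucc, Fin.snoc_last]
        rw [← hkz]
        simpa [Finset.sum_neg_distrib] using hk)
      rw [Fin.sum_univ_castSucc] at h1
      simp only [Fin.snoc_castSucc, Fin.snoc_last] at h1
      have h2 : ∑ i, b i * (y i.castSucc - a * f i.castSucc) ∈ q :=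
        sum_mem fun i _ => q.mul_mem_left _ (ha i)
      have h3 := sub_mem (add_mem h1 h2) (q.mul_mem_left a hk)
      convert h3 using 1
      have hs : ∑ i, b i * (y i.castSucc - a * f i.castSucc) =
          ∑ i, b i * y i.castSucc - a * ∑ i, b i * f i.castSucc := by
        rw [Finset.mul_sum, ← Finset.sum_sub_distrib]
        exact Finset.sum_congr rfl fun i _ => by ring
      rw [hs, hv]
      simp only [neg_mul, Finset.sum_neg_distrib]
      linear_combination a * hkz
    have hvN : v ∈ N := by
      rw [← hq.colon_colon (K := N) le_sup_right]
      rw [mem_colon_ideal]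
      intro r hr
      rw [mul_comm]
      refine hcol r ?_
      rw [← hq.colon_colon (K := K1) le_sup_left, mem_colon_ideal]
      intro t ht
      have := mem_colon_ideal.1 hr (t * f (Fin.last n))
        (Ideal.mem_sup_left (Ideal.mul_mem_mul ht (Ideal.mem_span_singleton_self _)))
      convert this using 1; ring
    obtain ⟨w, hw, k, hk, hwk⟩ := Submodule.mem_sup.1 hvN
    obtain ⟨b, hb, rfl⟩ := Ideal.mem_mul_span_singleton.1 hw
    refine ⟨a + b, fun i => ?_⟩
    induction i using Fin.lastCases with
    | last =>
      convert hk using 1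
      linear_combination (-1) * hwk
    | cast i =>
      have := sub_mem (ha i) (mem_colon_ideal.1 hb (f i.castSucc)
        (Ideal.mem_sup_right (Ideal.subset_span ⟨i, rfl⟩)))
      convert this using 1; ring

end DoubleAnnihilator

section Lifting

variable {R : Type*} [CommRing R]

lemma ExtensionProperty.colon_sup_span {c : Ideal R} {n : ℕ} {f : Fin n → R}
    (h : ExtensionProperty c f) {x : R} (hx : NzdMod c x) {u : R}
    (hu : ∀ i, u * f i ∈ c ⊔ Ideal.span {x}) : ∃ a, ∀ i, (u - x * a) * f i ∈ c := by
  choose y hy using fun i => exists_of_mem_sup_span (hu i)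
  obtain ⟨a, ha⟩ := h y (by
    intro r hr
    refine hx _ ?_
    have h1 : ∑ i, r i * (u * f i - x * y i) ∈ c := sum_mem fun i _ => c.mul_mem_left _ (hy i)
    have h2 := sub_mem (c.mul_mem_left u hr) h1
    convert h2 using 1
    rw [Finset.mul_sum, Finset.mul_sum, ← Finset.sum_sub_distrib]
    exact Finset.sum_congr rfl fun i _ => by ring)
  refine ⟨a, fun i => ?_⟩
  have := add_mem (hy i) (c.mul_mem_left x (ha i))
  convert this using 1; ring

lemma mem_colon_sup_span_range {c : Ideal R} {n : ℕ} {f : Fin n → R} {u : R} :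
    u ∈ c.colon ((c ⊔ Ideal.span (Set.range f) : Ideal R) : Set R) ↔ ∀ i, u * f i ∈ c := by
  rw [mem_colon_ideal]
  refine ⟨fun h i => h _ (Ideal.mem_sup_right (Ideal.subset_span ⟨i, rfl⟩)), fun h s hs => ?_⟩
  obtain ⟨k, hk, z, hz, rfl⟩ := Submodule.mem_sup.1 hs
  obtain ⟨b, rfl⟩ := Ideal.mem_span_range_iff_exists_fun.1 hz
  rw [mul_add, Finset.mul_sum]
  refine add_mem (c.mul_mem_left _ hk) (sum_mem fun i _ => ?_)
  have := c.mul_mem_left (b i) (h i)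
  convert this using 1; ring

variable [IsLocalRing R] [IsNoetherianRing R]

lemma ExtensionProperty.of_sup_span {c : Ideal R} {n : ℕ} {f : Fin n → R} {x : R}
    (hx : x ∈ maximalIdeal R) (nx : NzdMod c x)
    (nK : NzdMod (c ⊔ Ideal.span (Set.range f)) x)
    (h : ExtensionProperty (c ⊔ Ideal.span {x}) f) : ExtensionProperty c f := by
  let N : Submodule R (Fin n → R) :=
    { carrier := {y | ∀ r : Fin n → R, ∑ i, r i * f i ∈ c → ∑ i, r i * y i ∈ c}
      add_mem' := by
        intro y z hy hz r hr
        have := add_mem (hy r hr) (hz r hr)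
        rw [← Finset.sum_add_distrib] at this
        simpa [mul_add] using this
      zero_mem' := by intro r _; simp
      smul_mem' := by
        intro a y hy r hr
        have := c.mul_mem_left a (hy r hr)
        rw [Finset.mul_sum] at this
        convert this using 2
        simp only [Pi.smul_apply, smul_eq_mul]; ring }
  let C : Submodule R (Fin n → R) :=
    { carrier := {y | ∃ a, ∀ i, y i - a * f i ∈ c}
      add_mem' := by
        rintro y z ⟨a, ha⟩ ⟨b, hb⟩
        refine ⟨a + b, fun i => ?_⟩
        have := add_mem (ha i) (hb i)
        convert this using 1
        simp only [Pi.add_apply]; ring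
      zero_mem' := ⟨0, by simp⟩
      smul_mem' := by
        rintro b y ⟨a, ha⟩
        refine ⟨b * a, fun i => ?_⟩
        have := c.mul_mem_left b (ha i)
        convert this using 1
        simp only [Pi.smul_apply, smul_eq_mul]; ring }
  have key : N ≤ C := by
    refine Submodule.le_of_le_smul_of_le_jacobson_bot (I := maximalIdeal R)
      (IsNoetherian.noetherian N) (IsLocalRing.maximalIdeal_le_jacobson _) ?_
    intro y hy
    obtain ⟨a, ha⟩ := h y (by
      intro r hr
      obtain ⟨w, hw⟩ := exists_of_mem_sup_span hr
      have hw' : w ∈ c ⊔ Ideal.span (Set.range f) := by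
        refine nK _ ?_
        have hsum : ∑ i, r i * f i ∈ c ⊔ Ideal.span (Set.range f) := Ideal.mem_sup_right
          (sum_mem fun i _ => Ideal.mul_mem_left _ _ (Ideal.subset_span ⟨i, rfl⟩))
        have := sub_mem hsum (Ideal.mem_sup_left hw : _ ∈ c ⊔ Ideal.span (Set.range f))
        convert this using 1; ring
      obtain ⟨k, hk, z, hz, rfl⟩ := Submodule.mem_sup.1 hw'
      obtain ⟨s, rfl⟩ := Ideal.mem_span_range_iff_exists_fun.1 hz
      have h1 := hy (fun i => r i - x * s i) (by
        have := add_mem hw (c.mul_mem_left x hk)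
        convert this using 1
        have e : ∑ i, (r i - x * s i) * f i = ∑ i, r i * f i - x * ∑ i, s i * f i := by
          rw [Finset.mul_sum, ← Finset.sum_sub_distrib]
          exact Finset.sum_congr rfl fun i _ => by ring
        rw [e]; ring)
      refine mem_sup_span_of_sub (∑ i, s i * y i) ?_
      convert h1 using 1
      rw [Finset.mul_sum, ← Finset.sum_sub_distrib]
      exact Finset.sum_congr rfl fun i _ => by ring)
    choose z hz using fun i => exists_of_mem_sup_span (ha i)
    have hzN : z ∈ N := by
      intro r hr
      refine nx _ ?_
      have h1 : ∑ i, r i * (y i - a * f i - x * z i) ∈ c :=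
        sum_mem fun i _ => c.mul_mem_left _ (hz i)
      have h2 := sub_mem (sub_mem (hy r hr) (c.mul_mem_left a hr)) h1
      convert h2 using 1
      rw [Finset.mul_sum, Finset.mul_sum, ← Finset.sum_sub_distrib, ← Finset.sum_sub_distrib]
      exact Finset.sum_congr rfl fun i _ => by ring
    refine Submodule.mem_sup.2 ⟨y - x • z, ⟨a, fun i => ?_⟩, x • z,
      Submodule.smul_mem_smul hx hzN, by simp⟩
    convert hz i using 1
    simp only [Pi.sub_apply, Pi.smul_apply, smul_eq_mul]; ring
  exact fun y hy => key hy

lemma QuasiFrobeniusMod.lift (xs : List R) {c : Ideal R} {n : ℕ} (f : Fin n → R)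
    (hxs : ∀ x ∈ xs, x ∈ maximalIdeal R) (wc : WeaklyRegularMod c xs)
    (wK : WeaklyRegularMod (c ⊔ Ideal.span (Set.range f)) xs)
    (hq : QuasiFrobeniusMod (c ⊔ Ideal.ofList xs)) :
    ExtensionProperty c f ∧
    c.colon (c.colon ((c ⊔ Ideal.span (Set.range f) : Ideal R) : Set R) : Set R) =
      c ⊔ Ideal.span (Set.range f) ∧
    WeaklyRegularMod (c.colon ((c ⊔ Ideal.span (Set.range f) : Ideal R) : Set R)) xs := by
  induction xs generalizing c with
  | nil =>
    have hq' : QuasiFrobeniusMod c := by simpa using hq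
    exact ⟨hq'.extensionProperty f, hq'.colon_colon le_sup_left, trivial⟩
  | cons x xs ih =>
    obtain ⟨nx, wc'⟩ := wc
    obtain ⟨nK, wK'⟩ := wK
    have hx := hxs x List.mem_cons_self
    rw [sup_right_comm] at wK'
    obtain ⟨h1, h2, h3⟩ := ih (fun z hz => hxs z (List.mem_cons_of_mem _ hz)) wc' wK'
      (by rwa [sup_assoc, ← Ideal.ofList_cons])
    have hE := h1.of_sup_span hx nx nK
    set K := c ⊔ Ideal.span (Set.range f) with hK
    have hcol : (c ⊔ Ideal.span {x}).colon
        ((c ⊔ Ideal.span {x} ⊔ Ideal.span (Set.range f) : Ideal R) : Set R) =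
        c.colon (K : Set R) ⊔ Ideal.span {x} := by
      ext u
      rw [mem_colon_sup_span_range, mem_sup_span_iff]
      constructor
      · intro hu
        obtain ⟨a, ha⟩ := hE.colon_sup_span nx hu
        exact ⟨a, mem_colon_sup_span_range.2 ha⟩
      · rintro ⟨a, ha⟩ i
        rw [hK, mem_colon_sup_span_range] at ha
        refine mem_sup_span_of_sub (a * f i) ?_
        convert ha i using 1; ring
    rw [hcol] at h2 h3
    refine ⟨hE, le_antisymm ?_ (le_colon_colon c K), nx.colon K, h3⟩
    refine le_of_forall_mem_exists_mul hx fun u hu => ?_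
    have hu' : u ∈ K ⊔ Ideal.span {x} := by
      rw [hK, sup_right_comm, ← h2, mem_colon_ideal]
      intro s hs
      obtain ⟨v, hv⟩ := exists_of_mem_sup_span hs
      refine mem_sup_span_of_sub (u * v) ?_
      convert mem_colon_ideal.1 hu _ hv using 1; ring
    obtain ⟨v, hv⟩ := exists_of_mem_sup_span hu'
    refine ⟨v, (nx.colon (c.colon (K : Set R))) v ?_, hv⟩
    have := sub_mem hu (le_colon_colon c K hv)
    convert this using 1; ring

end Lifting

section Gorenstein

variable {R : Type*} [CommRing R] [IsLocalRing R]

/-- There is a regular sequence of length `d` generating an ideal whose quotient is Artinian with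
cyclic socle. -/
def GorensteinOfDim (R : Type*) [CommRing R] [IsLocalRing R] (d : ℕ) : Prop :=
  ∃ xs : List R, xs.length = d ∧ (∀ x ∈ xs, x ∈ maximalIdeal R) ∧ WeaklyRegularMod ⊥ xs ∧
    QuasiFrobeniusMod (Ideal.ofList xs)

lemma ofList_ne_top {xs : List R} (h : ∀ x ∈ xs, x ∈ maximalIdeal R) : Ideal.ofList xs ≠ ⊤ :=
  ne_top_of_le_ne_top (maximalIdeal.isMaximal R).ne_top (Ideal.span_le.2 h)

lemma maximalIdeal_le_radical_iff {q : Ideal R} (hq : q ≠ ⊤) :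
    maximalIdeal R ≤ q.radical ↔ ringKrullDim (R ⧸ q) = 0 := by
  have := Ideal.Quotient.nontrivial_iff.2 hq
  rw [← ringKrullDimZero_iff_ringKrullDim_eq_zero, Ring.krullDimLE_zero_iff]
  constructor
  · intro h P hP
    have h1 : (P.comap (Ideal.Quotient.mk q)).IsPrime := Ideal.comap_isPrime _ _
    have h2 : q ≤ P.comap (Ideal.Quotient.mk q) := by
      intro x hx
      rw [Ideal.mem_comap, Ideal.Quotient.eq_zero_iff_mem.2 hx]; exact zero_mem _
    have h3 := h.trans ((h1.radical_le_iff).2 h2)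
    have h4 : (P.comap (Ideal.Quotient.mk q)).IsMaximal := by
      rw [← (maximalIdeal.isMaximal R).eq_of_le h1.ne_top h3]; exact maximalIdeal.isMaximal R
    rw [← Ideal.map_comap_of_surjective _ Ideal.Quotient.mk_surjective P]
    exact (Ideal.map_eq_top_or_isMaximal_of_surjective _ Ideal.Quotient.mk_surjective
      h4).resolve_left (by
        rw [Ideal.map_comap_of_surjective _ Ideal.Quotient.mk_surjective P]
        exact hP.ne_top)
  · intro h x hx
    rw [Ideal.radical_eq_sInf, Ideal.mem_sInf]
    rintro J ⟨hqJ, hJ⟩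
    have h1 : (J.map (Ideal.Quotient.mk q)).IsPrime :=
      Ideal.map_isPrime_of_surjective Ideal.Quotient.mk_surjective (by rwa [Ideal.mk_ker])
    have h2 := Ideal.comap_isMaximal_of_surjective (Ideal.Quotient.mk q)
      Ideal.Quotient.mk_surjective (K := J.map (Ideal.Quotient.mk q)) (H := h _ h1)
    rw [Ideal.comap_map_of_surjective _ Ideal.Quotient.mk_surjective, ← RingHom.ker_eq_comap_bot,
      Ideal.mk_ker, sup_eq_left.2 hqJ] at h2
    rwa [eq_maximalIdeal h2]

/-- The ideal `K` is proper, has grade at least `g`, and `R ⧸ K` has depth at least `n`. If `R` is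
Gorenstein of dimension `g + n`, this says that `K` is a Cohen-Macaulay ideal of grade `g`. -/
def GradeDepth (g n : ℕ) (K : Ideal R) : Prop :=
  K ≠ ⊤ ∧ HasRegularSeq K ⊥ g ∧ HasRegularSeq (maximalIdeal R) K n

lemma GradeDepth.maximalIdeal {d : ℕ} (h : GorensteinOfDim R d) :
    GradeDepth d 0 (maximalIdeal R) := by
  obtain ⟨xs, h1, h2, h3, -⟩ := h
  exact ⟨(maximalIdeal.isMaximal R).ne_top, ⟨xs, h1, h2, h3⟩, [], rfl, by simp, trivial⟩

lemma GorensteinOfDim.hasRegularSeq {d : ℕ} (h : GorensteinOfDim R d) :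
    HasRegularSeq (IsLocalRing.maximalIdeal R) ⊥ d :=
  (GradeDepth.maximalIdeal h).2.1

variable [IsNoetherianRing R]

lemma ringKrullDim_quotient_add_length {xs : List R} (h : ∀ x ∈ xs, x ∈ maximalIdeal R)
    (w : WeaklyRegularMod ⊥ xs) :
    ringKrullDim (R ⧸ Ideal.ofList xs) + xs.length = ringKrullDim R :=
  ringKrullDim_add_length_eq_ringKrullDim_of_isRegular xs
    ((isRegular_iff_weaklyRegularMod xs).2 ⟨w, ofList_ne_top h⟩)

lemma GorensteinOfDim.ringKrullDim_eq {d : ℕ} (h : GorensteinOfDim R d) : ringKrullDim R = d := by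
  obtain ⟨xs, rfl, h2, h3, h4⟩ := h
  rw [← ringKrullDim_quotient_add_length h2 h3,
    (maximalIdeal_le_radical_iff (ofList_ne_top h2)).1 h4.1, zero_add]

lemma GorensteinOfDim.quasiFrobeniusMod {ys : List R} (h : GorensteinOfDim R ys.length)
    (hy : ∀ y ∈ ys, y ∈ maximalIdeal R) (wy : WeaklyRegularMod ⊥ ys) :
    QuasiFrobeniusMod (Ideal.ofList ys) := by
  have h1 := ringKrullDim_quotient_add_length hy wy
  rw [h.ringKrullDim_eq] at h1
  obtain ⟨xs, h2, h3, h4, h5⟩ := h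
  refine ⟨(maximalIdeal_le_radical_iff (ofList_ne_top hy)).2 ?_, ?_⟩
  · refine (ENat.WithBot.add_natCast_cancel (c := ys.length)).1 ?_
    rw [h1, zero_add]
  · have := CyclicSocleMod.of_regular h2.symm h3 hy h4 wy (by simpa using h5.2)
    simpa using this

lemma gorensteinOfDim_of_isGorensteinLocalRing {R : Type} [CommRing R] [IsLocalRing R]
    [IsNoetherianRing R] (h : IsGorensteinLocalRing R) : ∃ d, GorensteinOfDim R d := by
  obtain ⟨-, rs, h1, h2, h3⟩ := h
  rw [isRegular_iff_weaklyRegularMod] at h1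
  refine ⟨rs.length, rs, rfl, fun x hx => ?_, h1.1, h2.ge, cyclicSocleMod_of_infIrred h3⟩
  exact le_maximalIdeal h1.2 (Ideal.subset_span hx)

lemma GradeDepth.colon_eq_self {g n : ℕ} {K : Ideal R} (hK : GradeDepth g n K) {cs : List R} (hl : cs.length < g) (hc : ∀ c ∈ cs, c ∈ K)
    (wc : WeaklyRegularMod ⊥ cs) : (Ideal.ofList cs).colon (K : Set R) = Ideal.ofList cs := by
  obtain ⟨xs, h1, h2, h3⟩ := hK.2.1
  obtain ⟨y, hy, h4⟩ := WeaklyRegularMod.exists_snoc (le_maximalIdeal hK.1) (by rwa [h1]) h2 hc h3 wc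
  rw [weaklyRegularMod_append, bot_sup_eq] at h4
  refine le_antisymm (fun u hu => h4.2.1 u ?_) (le_colon _ _)
  rw [mul_comm]
  exact mem_colon_ideal.1 hu y hy

section

variable {g n : ℕ} (hR : GorensteinOfDim R (g + n)) {K : Ideal R} (hK : GradeDepth g n K)
include hR hK

lemma GradeDepth.exists_lift {cs : List R} (hl : cs.length = g) (hc : ∀ c ∈ cs, c ∈ K)
    (wc : WeaklyRegularMod ⊥ cs) :
    ∃ xs : List R, xs.length = n ∧ (∀ x ∈ xs, x ∈ IsLocalRing.maximalIdeal R) ∧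
      WeaklyRegularMod (Ideal.ofList cs) xs ∧ WeaklyRegularMod K xs ∧
      QuasiFrobeniusMod (Ideal.ofList cs ⊔ Ideal.ofList xs) := by
  have hcm : ∀ c ∈ cs, c ∈ IsLocalRing.maximalIdeal R := fun c h => le_maximalIdeal hK.1 (hc c h)
  obtain ⟨xs, h1, h2, h3, h4⟩ := exists_common_regularSeq le_rfl
    ((hl ▸ hR.hasRegularSeq).sup_ofList le_rfl hcm wc) hK.2.2
  rw [bot_sup_eq] at h3
  refine ⟨xs, h1, h2, h3, h4, ?_⟩
  rw [← Ideal.ofList_append]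
  refine GorensteinOfDim.quasiFrobeniusMod (by rwa [List.length_append, hl, h1]) ?_ ?_
  · simpa [or_imp, forall_and] using ⟨hcm, h2⟩
  · rw [weaklyRegularMod_append, bot_sup_eq]
    exact ⟨wc, h3⟩

lemma GradeDepth.extensionProperty {cs : List R} (hl : cs.length = g) (hc : ∀ c ∈ cs, c ∈ K)
    (wc : WeaklyRegularMod ⊥ cs) {k : ℕ} (f : Fin k → R) (hf : Ideal.span (Set.range f) = K) :
    ExtensionProperty (Ideal.ofList cs) f := by
  obtain ⟨xs, h1, h2, h3, h4, h5⟩ := hK.exists_lift hR hl hc wc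
  have : Ideal.ofList cs ⊔ Ideal.span (Set.range f) = K := by
    rw [hf, sup_eq_right]; exact Ideal.span_le.2 hc
  exact (h5.lift xs f h2 h3 (by rwa [this])).1

lemma GradeDepth.colon_colon {cs : List R} (hl : cs.length = g) (hc : ∀ c ∈ cs, c ∈ K)
    (wc : WeaklyRegularMod ⊥ cs) :
    (Ideal.ofList cs).colon ((Ideal.ofList cs).colon (K : Set R) : Set R) = K := by
  obtain ⟨xs, h1, h2, h3, h4, h5⟩ := hK.exists_lift hR hl hc wc
  obtain ⟨k, f, hf⟩ := Submodule.fg_iff_exists_fin_generating_family.1 (IsNoetherian.noetherian K)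
  have : Ideal.ofList cs ⊔ Ideal.span (Set.range f) = K := by
    rw [Ideal.span, hf, sup_eq_right]; exact Ideal.span_le.2 hc
  have h6 := (h5.lift xs f h2 h3 (by rwa [this])).2.1
  rwa [this] at h6

lemma GradeDepth.colon {cs : List R} (hl : cs.length = g) (hc : ∀ c ∈ cs, c ∈ K)
    (wc : WeaklyRegularMod ⊥ cs) : (Ideal.ofList cs).colon (K : Set R) = ⊤ ∨
      GradeDepth g n ((Ideal.ofList cs).colon (K : Set R)) := by
  obtain ⟨xs, h1, h2, h3, h4, h5⟩ := hK.exists_lift hR hl hc wc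
  obtain ⟨k, f, hf⟩ := Submodule.fg_iff_exists_fin_generating_family.1 (IsNoetherian.noetherian K)
  have : Ideal.ofList cs ⊔ Ideal.span (Set.range f) = K := by
    rw [Ideal.span, hf, sup_eq_right]; exact Ideal.span_le.2 hc
  have h6 := (h5.lift xs f h2 h3 (by rwa [this])).2.2
  rw [this] at h6
  rw [or_iff_not_imp_left]
  exact fun hne => ⟨hne, ⟨cs, hl, fun c h => le_colon _ _ (Ideal.subset_span h), wc⟩, xs, h1, h2, h6⟩

lemma GradeDepth.length_le {zs : List R} (hz : ∀ z ∈ zs, z ∈ K) (wz : WeaklyRegularMod ⊥ zs) :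
    zs.length ≤ g := by
  by_contra! hlt
  obtain ⟨cs, h1, h2, h3⟩ := hK.2.1
  obtain ⟨y, hy, h4⟩ := WeaklyRegularMod.exists_snoc (le_maximalIdeal hK.1) (by rwa [h1]) hz h2 wz h3
  rw [weaklyRegularMod_append, bot_sup_eq] at h4
  have h5 := hK.colon_colon hR h1 h2 h3
  refine hK.1 ?_
  rw [← h5, Ideal.eq_top_iff_one, mem_colon_ideal]
  intro u hu
  rw [one_mul]
  refine h4.2.1 u ?_
  rw [mul_comm]
  exact mem_colon_ideal.1 hu y hy

end

end Gorenstein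

section Grade

variable {R : Type} [CommRing R] [IsLocalRing R] [IsNoetherianRing R]

lemma GradeDepth.gradeOf_eq {g n : ℕ} (hR : GorensteinOfDim R (g + n)) {K : Ideal R}
    (hK : GradeDepth g n K) : gradeOf R K = g := by
  refine IsGreatest.csSup_eq ⟨?_, ?_⟩
  · obtain ⟨xs, h1, h2, h3⟩ := hK.2.1
    exact ⟨xs, h1, h2, (isRegular_iff_weaklyRegularMod _).2
      ⟨h3, ofList_ne_top fun x hx => le_maximalIdeal hK.1 (h2 x hx)⟩⟩
  · rintro m ⟨zs, rfl, h2, h3⟩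
    exact hK.length_le hR h2 ((isRegular_iff_weaklyRegularMod _).1 h3).1

lemma GorensteinOfDim.gradeOf_top {d : ℕ} (hR : GorensteinOfDim R d) : gradeOf R ⊤ = d := by
  rw [← (GradeDepth.maximalIdeal hR).gradeOf_eq (by simpa using hR)]
  unfold gradeOf
  congr 1
  ext m
  constructor
  · rintro ⟨zs, h1, -, h3⟩
    refine ⟨zs, h1, fun z hz => ?_, h3⟩
    exact le_maximalIdeal ((isRegular_iff_weaklyRegularMod _).1 h3).2 (Ideal.subset_span hz)
  · rintro ⟨zs, h1, -, h3⟩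
    exact ⟨zs, h1, fun _ _ => trivial, h3⟩

lemma GradeDepth.of_isCMIdeal {d : ℕ} (hR : GorensteinOfDim R d) {I : Ideal R}
    (hI : IsCMIdeal R I) (hpos : ∃ r ∈ I, r ∈ nonZeroDivisors R) :
    ∃ g n, g + n = d ∧ 1 ≤ g ∧ GradeDepth g n I := by
  obtain ⟨hloc, hCM⟩ := hI
  have hne : I ≠ ⊤ := Ideal.Quotient.nontrivial_iff.1 inferInstance
  have hIm := le_maximalIdeal hne
  -- the depth of the quotient
  obtain ⟨xs, hx1, hx2, hx3⟩ : HasRegularSeq (IsLocalRing.maximalIdeal R) I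
      (gradeOf (R ⧸ I) (IsLocalRing.maximalIdeal (R ⧸ I))) := by
    have hmem := Nat.sSup_mem (s := {n : ℕ | ∃ rs : List (R ⧸ I), rs.length = n ∧
        (∀ r ∈ rs, r ∈ IsLocalRing.maximalIdeal (R ⧸ I)) ∧ RingTheory.Sequence.IsRegular (R ⧸ I) rs})
      ⟨0, [], rfl, by simp, (isRegular_iff_weaklyRegularMod _).2 ⟨trivial, by simp⟩⟩
      ⟨gradeOf (R ⧸ I) (IsLocalRing.maximalIdeal (R ⧸ I)), by
        rintro m ⟨rs, rfl, h2, h3⟩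
        have h4 := ringKrullDim_quotient_add_length h2 ((isRegular_iff_weaklyRegularMod _).1 h3).1
        rw [hCM] at h4
        have := Ideal.Quotient.nontrivial_iff.2 (ofList_ne_top h2)
        have h5 : (0 : WithBot ℕ∞) ≤ ringKrullDim ((R ⧸ I) ⧸ Ideal.ofList rs) :=
          ringKrullDim_nonneg_of_nontrivial
        have h6 : (rs.length : WithBot ℕ∞) ≤
            (gradeOf (R ⧸ I) (IsLocalRing.maximalIdeal (R ⧸ I)) : ℕ) :=
          (le_add_of_nonneg_left h5).trans h4.le
        exact_mod_cast h6⟩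
    obtain ⟨rs, h1, h2, h3⟩ := hmem
    obtain ⟨xs, rfl⟩ := List.map_surjective_iff.2 (Ideal.Quotient.mk_surjective (I := I)) rs
    refine ⟨xs, (List.length_map _).symm.trans h1, fun x hx => ?_, ?_⟩
    · have := h2 _ (List.mem_map_of_mem hx)
      rw [mem_maximalIdeal, mem_nonunits_iff] at this ⊢
      exact fun h => this (h.map _)
    · have := (weaklyRegularMod_comap_iff Ideal.Quotient.mk_surjective ⊥ xs).2
        ((isRegular_iff_weaklyRegularMod _).1 h3).1
      rwa [← RingHom.ker_eq_comap_bot, Ideal.mk_ker] at this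
  -- a maximal regular sequence in the ideal
  have hbdd : ∀ cs : List R, (∀ c ∈ cs, c ∈ I) → WeaklyRegularMod ⊥ cs → cs.length ≤ d :=
    fun cs h1 h2 => (GradeDepth.maximalIdeal hR).length_le (by simpa using hR)
      (fun c hc => hIm (h1 c hc)) h2
  obtain ⟨g, hg, hmax⟩ : ∃ g, HasRegularSeq I ⊥ g ∧ ∀ m, HasRegularSeq I ⊥ m → m ≤ g := by
    have hb : BddAbove {m | HasRegularSeq I ⊥ m} := ⟨d, by
      rintro m ⟨cs, rfl, h1, h2⟩; exact hbdd cs h1 h2⟩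
    exact ⟨sSup {m | HasRegularSeq I ⊥ m},
      Nat.sSup_mem (s := {m | HasRegularSeq I ⊥ m}) ⟨0, [], rfl, by simp, trivial⟩ hb,
      fun m hm => le_csSup hb hm⟩
  obtain ⟨cs, hc1, hc2, hc3⟩ := hg
  have hgd : g ≤ d := hc1 ▸ hbdd cs hc2 hc3
  have hg1 : 1 ≤ g := by
    obtain ⟨r, hr, hr'⟩ := hpos
    refine hmax 1 ⟨[r], rfl, by simpa using hr, fun u hu => ?_, trivial⟩
    rw [Ideal.mem_bot] at hu ⊢
    exact (mem_nonZeroDivisors_iff.1 hr').1 u hu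
  obtain ⟨u, hu1, hu2⟩ : ∃ u, u ∉ Ideal.ofList cs ∧ ∀ r ∈ I, r * u ∈ Ideal.ofList cs := by
    by_contra! hcon
    have htf : TorsionFreeMod I (Ideal.ofList cs) := by
      intro u hu
      by_contra hu'
      obtain ⟨r, hr, hr'⟩ := hcon u hu'
      exact hr' (hu r hr)
    obtain ⟨z, hz, nz, -⟩ := exists_nzdMod_of_torsionFree htf htf
    have := hmax (g + 1) ⟨cs ++ [z], by simp [hc1],
      by simpa [or_imp, forall_and] using ⟨hc2, hz⟩, hc3.snoc (by rwa [bot_sup_eq])⟩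
    omega
  obtain ⟨ys, hy1, hy2, hy3⟩ := HasRegularSeq.sup_ofList (n := d - g) le_rfl
    (by rw [hc1, Nat.add_sub_cancel' hgd]; exact hR.hasRegularSeq)
    (fun c hc => hIm (hc2 c hc)) hc3
  rw [bot_sup_eq] at hy3
  have hdim := length_le_ringKrullDim_of_annihilates hy2 hy3 hu1 hu2
  rw [hCM, hy1, ← hx1] at hdim
  have hdim' : ((d - g : ℕ) : WithBot ℕ∞) ≤ (xs.length : ℕ) := hdim
  rw [Nat.cast_le] at hdim'
  exact ⟨g, d - g, Nat.add_sub_cancel' hgd, hg1, hne, ⟨cs, hc1, hc2, hc3⟩, xs.take (d - g),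
    by simpa using hdim', fun x hx => hx2 x (List.mem_of_mem_take hx), hx3.take _⟩

end Grade

section LinkChain

lemma ofList_ofFn {R : Type*} [CommRing R] {g : ℕ} (c : Fin g → R) :
    Ideal.ofList (List.ofFn c) = Ideal.span (Set.range c) := by
  unfold Ideal.ofList
  congr 1
  ext x
  simp [List.mem_ofFn']

/-- The ideal `K` reaches the unit ideal after at most `t` links by regular sequences of
length `g`. -/
def LinkChain (g : ℕ) {R : Type*} [CommRing R] : ℕ → Ideal R → Prop
  | 0, K => K = ⊤
  | t + 1, K => K = ⊤ ∨ ∃ c : Fin g → R, (∀ i, c i ∈ K) ∧ WeaklyRegularMod ⊥ (List.ofFn c) ∧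
      LinkChain g t ((Ideal.span (Set.range c)).colon (K : Set R))

lemma LinkChain.top (g : ℕ) {R : Type*} [CommRing R] (t : ℕ) : LinkChain g t (⊤ : Ideal R) := by
  cases t with
  | zero => exact rfl
  | succ t => exact Or.inl rfl

section Self

variable {R : Type} [CommRing R]

lemma isDirectlyLinked_self {ys : List R} {x : R} {I : Ideal R} (hI : I ≠ ⊤)
    (w : WeaklyRegularMod ⊥ (ys ++ [x])) (h : Ideal.ofList (ys ++ [x]) = I) :
    IsDirectlyLinked R I I := by
  rw [weaklyRegularMod_append, bot_sup_eq] at w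
  obtain ⟨w1, w2, -⟩ := w
  have hI' : I = Ideal.ofList ys ⊔ Ideal.span {x} := by
    rw [← h, Ideal.ofList_append, Ideal.ofList_singleton]
  have hc : Ideal.ofList (ys ++ [x * x]) = Ideal.ofList ys ⊔ Ideal.span {x * x} := by
    rw [Ideal.ofList_append, Ideal.ofList_singleton]
  have hle : Ideal.ofList (ys ++ [x * x]) ≤ I := by
    rw [hc, hI']
    refine sup_le_sup_left ((Ideal.span_singleton_le_iff_mem _).2 ?_) _
    exact Ideal.mul_mem_left _ _ (Ideal.mem_span_singleton_self x)
  have hcol : (Ideal.ofList (ys ++ [x * x])).colon (I : Set R) = I := by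
    ext u
    rw [mem_colon_ideal, hc]
    constructor
    · intro hu
      obtain ⟨v, hv⟩ := exists_of_mem_sup_span
        (hu x (hI' ▸ Ideal.mem_sup_right (Ideal.mem_span_singleton_self x)))
      rw [hI']
      refine mem_sup_span_of_sub v (w2 _ ?_)
      convert hv using 1; ring
    · intro hu s hs
      rw [hI'] at hu hs
      obtain ⟨v, hv⟩ := exists_of_mem_sup_span hu
      obtain ⟨t, ht⟩ := exists_of_mem_sup_span hs
      refine mem_sup_span_of_sub (v * t) ?_
      have := add_mem (Ideal.mul_mem_right s _ hv) (Ideal.mul_mem_left _ (x * v) ht)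
      convert this using 1; ring
  refine ⟨hI, hI, _, ⟨ne_top_of_le_ne_top hI hle, _, ?_, rfl⟩, le_inf hle hle, hcol, hcol⟩
  refine (isRegular_iff_weaklyRegularMod _).2 ⟨w1.snoc ?_, ne_top_of_le_ne_top hI hle⟩
  rw [bot_sup_eq]
  exact fun u hu => w2 u (w2 _ (by rwa [mul_assoc] at hu))

lemma linkedInSteps_self {I : Ideal R} (h : IsDirectlyLinked R I I) (e : ℕ) :
    LinkedInSteps R e I I := by
  induction e with
  | zero => exact rfl
  | succ e ih => exact ⟨I, h, ih⟩

lemma exists_linkedInSteps_of_colon_eq_top {g : ℕ} (hg : 1 ≤ g) {I : Ideal R} (hI : I ≠ ⊤) (e : ℕ)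
    (c : Fin g → R) (hc : ∀ i, c i ∈ I) (wc : WeaklyRegularMod ⊥ (List.ofFn c))
    (hK : (Ideal.span (Set.range c)).colon (I : Set R) = ⊤) :
    ∃ J : Ideal R, LinkedInSteps R e I J ∧ IsCompleteIntersectionIdeal R J := by
  have hle : I ≤ Ideal.span (Set.range c) := fun s hs => by
    simpa using mem_colon_ideal.1 ((Ideal.eq_top_iff_one _).1 hK) s hs
  have hIc : Ideal.ofList (List.ofFn c) = I := by
    rw [ofList_ofFn]
    exact le_antisymm (Ideal.span_le.2 (by rintro _ ⟨i, rfl⟩; exact hc i)) hle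
  refine ⟨I, linkedInSteps_self ?_ e, hI, _,
    (isRegular_iff_weaklyRegularMod _).2 ⟨wc, by rw [hIc]; exact hI⟩, hIc⟩
  obtain h0 | ⟨ys, x, hyx⟩ := (List.ofFn c).eq_nil_or_concat'
  · have := congrArg List.length h0
    simp at this; omega
  · rw [hyx] at wc hIc
    exact isDirectlyLinked_self hI wc hIc

end Self

variable {R : Type} [CommRing R] [IsLocalRing R] [IsNoetherianRing R]
  {g n : ℕ} (hR : GorensteinOfDim R (g + n))
include hR

lemma exists_linkedInSteps_of_linkChain (hg : 1 ≤ g) (e : ℕ) {I : Ideal R}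
    (hI : GradeDepth g n I) (h : LinkChain g (e + 1) I) :
    ∃ J : Ideal R, LinkedInSteps R e I J ∧ IsCompleteIntersectionIdeal R J := by
  induction e generalizing I with
  | zero =>
    obtain h | ⟨c, hc, wc, hK⟩ := h
    · exact absurd h hI.1
    · exact exists_linkedInSteps_of_colon_eq_top hg hI.1 0 c hc wc hK
  | succ e ih =>
    obtain h | ⟨c, hc, wc, hK⟩ := h
    · exact absurd h hI.1
    have hc' : ∀ x ∈ List.ofFn c, x ∈ I := by
      intro x hx
      obtain ⟨i, rfl⟩ := (List.mem_ofFn' c x).1 hx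
      exact hc i
    rw [← ofList_ofFn] at hK
    rcases hI.colon hR (by simp) hc' wc with htop' | hgood
    · exact exists_linkedInSteps_of_colon_eq_top hg hI.1 (e + 1) c hc wc (by rwa [ofList_ofFn] at htop')
    obtain ⟨J, hJ1, hJ2⟩ := ih hgood hK
    refine ⟨J, ⟨_, ⟨hI.1, hgood.1, Ideal.ofList (List.ofFn c), ⟨?_, _, ?_, rfl⟩, ?_, ?_, rfl⟩, hJ1⟩,
      hJ2⟩
    · exact ofList_ne_top fun x hx => le_maximalIdeal hI.1 (hc' x hx)
    · exact (isRegular_iff_weaklyRegularMod _).2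
        ⟨wc, ofList_ne_top fun x hx => le_maximalIdeal hI.1 (hc' x hx)⟩
    · exact le_inf (Ideal.span_le.2 hc') (le_colon _ _)
    · exact hI.colon_colon hR (by simp) hc' wc

lemma exists_ofFn_of_complete_intersection {I c : Ideal R} (hI : GradeDepth g n I) (hc : c ≤ I)
    (hci : IsCompleteIntersectionIdeal R c) (hne : c.colon (I : Set R) ≠ c) :
    ∃ x : Fin g → R, (∀ i, x i ∈ I) ∧ WeaklyRegularMod ⊥ (List.ofFn x) ∧
      Ideal.span (Set.range x) = c := by
  obtain ⟨-, rs, hrs, rfl⟩ := hci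
  have hmem : ∀ r ∈ rs, r ∈ I := fun r hr => hc (Ideal.subset_span hr)
  have w := ((isRegular_iff_weaklyRegularMod _).1 hrs).1
  have hl : rs.length = g := by
    refine (hI.length_le hR hmem w).antisymm (not_lt.1 fun hlt => hne ?_)
    exact hI.colon_eq_self hlt hmem w
  subst hl
  refine ⟨rs.get, fun i => hmem _ (List.get_mem _ _), by rwa [List.ofFn_get], ?_⟩
  rw [← ofList_ofFn, List.ofFn_get]

lemma linkChain_of_linkedInSteps (e : ℕ) {I J : Ideal R} (hI : GradeDepth g n I)
    (h : LinkedInSteps R e I J) (hJ : IsCompleteIntersectionIdeal R J) : LinkChain g (e + 1) I := by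
  induction e generalizing I with
  | zero =>
    obtain rfl : I = J := h
    obtain ⟨x, h1, h2, h3⟩ := exists_ofFn_of_complete_intersection hR hI le_rfl hJ
      (by rw [colon_self]; exact hI.1.symm)
    refine Or.inr ⟨x, h1, h2, ?_⟩
    rw [h3]
    exact colon_self I
  | succ e ih =>
    obtain ⟨K, ⟨-, hK, c, hc, hle, h1, h2⟩, h3⟩ := h
    obtain ⟨x, h4, h5, h6⟩ := exists_ofFn_of_complete_intersection hR hI (hle.trans inf_le_left) hc
      (by
        intro heq
        rw [heq] at h2
        rw [← h2, colon_self] at h1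
        exact hI.1 h1.symm)
    refine Or.inr ⟨x, h4, h5, ?_⟩
    rw [h6, h2]
    refine ih ?_ h3
    have hgood := hI.colon hR (cs := List.ofFn x) (by simp) (by
      intro y hy
      obtain ⟨i, rfl⟩ := (List.mem_ofFn' x y).1 hy
      exact h4 i) h5
    rw [ofList_ofFn, h6, h2] at hgood
    exact hgood.resolve_left hK

end LinkChain

section Flat

variable {R B : Type*} [CommRing R] [CommRing B] [Algebra R B]

lemma mem_map_span_range {n : ℕ} {f : Fin n → R} {b : B} :
    b ∈ (Ideal.span (Set.range f)).map (algebraMap R B) ↔ ∃ y : Fin n → B, ∑ i, f i • y i = b := by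
  rw [Ideal.map_span, ← Set.range_comp, Ideal.mem_span_range_iff_exists_fun]
  simp [Algebra.smul_def, mul_comm]

variable [Module.Flat R B]

lemma mem_map_colon_singleton_of_flat {c : Ideal R} (hc : c.FG) {r : R} {b : B}
    (h : r • b ∈ c.map (algebraMap R B)) : b ∈ (c.colon ({r} : Set R)).map (algebraMap R B) := by
  obtain ⟨n, f, rfl⟩ := Submodule.fg_iff_exists_fin_generating_family.1 hc
  obtain ⟨y, hy⟩ := mem_map_span_range.1 h
  obtain ⟨k, a, z, h1, h2⟩ := Module.Flat.isTrivialRelation_of_sum_smul_eq_zero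
    (f := (fun o => o.elim r (fun i => - f i) : Option (Fin n) → R))
    (x := fun o => o.elim b y) (by simp [Fintype.sum_option, hy])
  have h3 := h1 none
  simp only [Option.elim_none] at h3
  rw [h3]
  refine sum_mem fun j _ => ?_
  rw [Algebra.smul_def]
  refine Ideal.mul_mem_right _ _ (Ideal.mem_map_of_mem _ ?_)
  have h4 := h2 j
  simp only [Fintype.sum_option, Option.elim_none, Option.elim_some] at h4
  rw [Submodule.mem_colon_singleton, smul_eq_mul]
  have : a none j * r = ∑ i, a (some i) j * f i := by
    rw [← sub_eq_zero, ← h4, mul_comm, sub_eq_add_neg, ← Finset.sum_neg_distrib]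
    congr 1
    exact Finset.sum_congr rfl fun i _ => by ring
  rw [this]
  exact sum_mem fun i _ => Ideal.mul_mem_left _ _ (Ideal.subset_span ⟨i, rfl⟩)

lemma mem_map_inf_of_flat {c c' : Ideal R} (hc : c.FG) (hc' : c'.FG) {b : B}
    (h : b ∈ c.map (algebraMap R B)) (h' : b ∈ c'.map (algebraMap R B)) :
    b ∈ (c ⊓ c').map (algebraMap R B) := by
  obtain ⟨n, f, rfl⟩ := Submodule.fg_iff_exists_fin_generating_family.1 hc
  obtain ⟨n', f', rfl⟩ := Submodule.fg_iff_exists_fin_generating_family.1 hc'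
  obtain ⟨y, hy⟩ := mem_map_span_range.1 h
  obtain ⟨y', hy'⟩ := mem_map_span_range.1 h'
  obtain ⟨k, a, z, h1, h2⟩ := Module.Flat.isTrivialRelation_of_sum_smul_eq_zero
    (f := Sum.elim f (fun i => - f' i)) (x := Sum.elim y y') (by simp [hy, hy'])
  simp only [Fintype.sum_sum_type, Sum.elim_inl, Sum.elim_inr, neg_mul, Finset.sum_neg_distrib,
    ← sub_eq_add_neg, sub_eq_zero] at h2
  have h3 : b = ∑ j, (∑ i, f i * a (Sum.inl i) j) • z j := by
    rw [← hy]
    simp_rw [Finset.sum_smul]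
    rw [Finset.sum_comm]
    refine Finset.sum_congr rfl fun i _ => ?_
    have := h1 (Sum.inl i)
    simp only [Sum.elim_inl] at this
    rw [this, Finset.smul_sum]
    exact Finset.sum_congr rfl fun j _ => by rw [mul_smul]
  rw [h3]
  refine sum_mem fun j _ => ?_
  rw [Algebra.smul_def]
  refine Ideal.mul_mem_right _ _ (Ideal.mem_map_of_mem _ ⟨?_, ?_⟩)
  · exact sum_mem fun i _ => Ideal.mul_mem_right _ _ (Ideal.subset_span ⟨i, rfl⟩)
  · rw [h2 j]
    exact sum_mem fun i _ => Ideal.mul_mem_right _ _ (Ideal.subset_span ⟨i, rfl⟩)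

lemma NzdMod.map {c : Ideal R} (hc : c.FG) {r : R} (h : NzdMod c r) :
    NzdMod (c.map (algebraMap R B)) (algebraMap R B r) := by
  intro u hu
  refine Ideal.map_mono ?_ (mem_map_colon_singleton_of_flat hc (r := r)
    (by rwa [Algebra.smul_def]))
  intro v hv
  rw [Submodule.mem_colon_singleton, smul_eq_mul] at hv
  exact h v (by rwa [mul_comm])

variable [IsNoetherianRing R]

lemma map_colon_of_flat (c K : Ideal R) :
    (c.colon (K : Set R)).map (algebraMap R B) =
      (c.map (algebraMap R B)).colon ((K.map (algebraMap R B) : Ideal B) : Set B) := by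
  refine le_antisymm (Ideal.map_le_iff_le_comap.2 fun u hu => ?_) fun b hb => ?_
  · rw [Ideal.mem_comap, mem_colon_ideal]
    intro s hs
    have : K.map (algebraMap R B) ≤ (c.map (algebraMap R B)).colon {algebraMap R B u} := by
      refine Ideal.map_le_iff_le_comap.2 fun k hk => ?_
      rw [Ideal.mem_comap, Submodule.mem_colon_singleton, smul_eq_mul, ← map_mul, mul_comm]
      exact Ideal.mem_map_of_mem _ (mem_colon_ideal.1 hu k hk)
    simpa [Submodule.mem_colon_singleton, mul_comm] using this hs
  · obtain ⟨S, rfl⟩ := IsNoetherian.noetherian K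
    have key : ∀ T : Finset R, (∀ s ∈ T, s • b ∈ c.map (algebraMap R B)) →
        b ∈ (c.colon (T : Set R)).map (algebraMap R B) := by
      classical
      intro T hT
      induction T using Finset.induction_on with
      | empty => simp [Ideal.map_top]
      | insert s T _ ih =>
        have h1 := mem_map_colon_singleton_of_flat (IsNoetherian.noetherian c)
          (hT s (Finset.mem_insert_self _ _))
        have h2 := ih fun s hs => hT s (Finset.mem_insert_of_mem hs)
        refine Ideal.map_mono ?_ (mem_map_inf_of_flat (IsNoetherian.noetherian _)
          (IsNoetherian.noetherian _) h1 h2)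
        rintro u ⟨hu1, hu2⟩
        rw [SetLike.mem_coe, Submodule.mem_colon] at hu1 hu2
        rw [Submodule.mem_colon]
        intro t ht
        rcases Finset.mem_insert.1 (Finset.mem_coe.1 ht) with rfl | ht
        · exact hu1 t rfl
        · exact hu2 t ht
    refine Ideal.map_mono ?_ (key S fun s hs => ?_)
    · rw [Submodule.colon_span]
    · rw [Algebra.smul_def, mul_comm]
      exact mem_colon_ideal.1 hb _ (Ideal.mem_map_of_mem _ (Submodule.subset_span hs))

lemma WeaklyRegularMod.map {K : Ideal R} {xs : List R} (h : WeaklyRegularMod K xs) :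
    WeaklyRegularMod (K.map (algebraMap R B)) (xs.map (algebraMap R B)) := by
  induction xs generalizing K with
  | nil => trivial
  | cons x xs ih =>
    refine ⟨h.1.map (IsNoetherian.noetherian K), ?_⟩
    have := ih h.2
    rwa [Ideal.map_sup, Ideal.map_span, Set.image_singleton] at this

lemma HasRegularSeq.map {I K : Ideal R} {n : ℕ} (h : HasRegularSeq I K n) :
    HasRegularSeq (I.map (algebraMap R B)) (K.map (algebraMap R B)) n := by
  obtain ⟨xs, h1, h2, h3⟩ := h
  refine ⟨xs.map (algebraMap R B), by simpa using h1, ?_, h3.map⟩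
  intro y hy
  obtain ⟨x, hx, rfl⟩ := List.mem_map.1 hy
  exact Ideal.mem_map_of_mem _ (h2 x hx)

lemma LinkChain.map {g t : ℕ} {K : Ideal R} (h : LinkChain g t K) :
    LinkChain g t (K.map (algebraMap R B)) := by
  induction t generalizing K with
  | zero =>
    obtain rfl : K = ⊤ := h
    exact Ideal.map_top _
  | succ t ih =>
    obtain rfl | ⟨c, h1, h2, h3⟩ := h
    · rw [Ideal.map_top]; exact LinkChain.top _ _
    · refine Or.inr ⟨fun i => algebraMap R B (c i), fun i => Ideal.mem_map_of_mem _ (h1 i), ?_, ?_⟩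
      · have := h2.map (B := B)
        rwa [Ideal.map_bot, List.map_ofFn] at this
      · have := ih h3
        rw [map_colon_of_flat, Ideal.map_span, ← Set.range_comp] at this
        exact this

end Flat

section FlatLocal

variable {R B : Type*} [CommRing R] [CommRing B] [Algebra R B] [Module.Flat R B]
  [IsNoetherianRing R] [IsLocalRing R] [IsLocalRing B]
  (hm : (IsLocalRing.maximalIdeal R).map (algebraMap R B) = IsLocalRing.maximalIdeal B)
include hm

lemma CyclicSocleMod.map {q : Ideal R} (h : CyclicSocleMod q) :
    CyclicSocleMod (q.map (algebraMap R B)) := by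
  obtain ⟨s, h1, h2⟩ := h
  have hs : q.colon (maximalIdeal R : Set R) ≤ q ⊔ Ideal.span {s} := by
    intro u hu
    exact h2 u fun r hr => by rw [mul_comm]; exact mem_colon_ideal.1 hu r hr
  have hs' : s ∈ q.colon (maximalIdeal R : Set R) :=
    mem_colon_ideal.2 fun r hr => by rw [mul_comm]; exact h1 r hr
  refine ⟨algebraMap R B s, fun r hr => ?_, fun u hu => ?_⟩
  · have := Ideal.mem_map_of_mem (algebraMap R B) hs'
    rw [map_colon_of_flat, hm] at this
    rw [mul_comm]; exact mem_colon_ideal.1 this r hr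
  · have h3 : u ∈ (q.colon (maximalIdeal R : Set R)).map (algebraMap R B) := by
      rw [map_colon_of_flat, hm]
      exact mem_colon_ideal.2 fun r hr => by rw [mul_comm]; exact hu r hr
    have := Ideal.map_mono hs h3
    rwa [Ideal.map_sup, Ideal.map_span, Set.image_singleton] at this

lemma GorensteinOfDim.map {d : ℕ} (h : GorensteinOfDim R d) : GorensteinOfDim B d := by
  obtain ⟨xs, h1, h2, h3, h4, h5⟩ := h
  refine ⟨xs.map (algebraMap R B), by simpa using h1, ?_, ?_, ?_, ?_⟩
  · intro y hy
    obtain ⟨x, hx, rfl⟩ := List.mem_map.1 hy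
    rw [← hm]
    exact Ideal.mem_map_of_mem _ (h2 x hx)
  · simpa [Ideal.map_bot] using h3.map (B := B)
  · rw [← Ideal.map_ofList, ← hm]
    exact (Ideal.map_mono h4).trans (Ideal.map_radical_le _)
  · rw [← Ideal.map_ofList]
    exact h5.map hm

lemma GradeDepth.map {g n : ℕ} {K : Ideal R} (h : GradeDepth g n K) :
    GradeDepth g n (K.map (algebraMap R B)) := by
  refine ⟨?_, ?_, ?_⟩
  · refine ne_top_of_le_ne_top (IsLocalRing.maximalIdeal.isMaximal B).ne_top ?_
    rw [← hm]
    exact Ideal.map_mono (le_maximalIdeal h.1)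
  · simpa [Ideal.map_bot] using h.2.1.map (B := B)
  · rw [← hm]; exact h.2.2.map

end FlatLocal

lemma ExtensionProperty.comap {S R : Type*} [CommRing S] [CommRing R] {π : S →+* R}
    (hπ : Function.Surjective π) {c : Ideal R} {k : ℕ} {f : Fin k → S}
    (h : ExtensionProperty c (π ∘ f)) : ExtensionProperty (c.comap π) f := by
  intro y hy
  obtain ⟨a, ha⟩ := h (π ∘ y) (by
    intro r hr
    choose r' hr' using fun i => hπ (r i)
    have := hy r' (by simpa [Ideal.mem_comap, hr'] using hr)
    simpa [Ideal.mem_comap, hr'] using this)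
  obtain ⟨a, rfl⟩ := hπ a
  exact ⟨a, fun i => by simpa [Ideal.mem_comap] using ha i⟩

section Deformation

variable {S R : Type*} [CommRing S] [CommRing R] {π : S →+* R} (hπ : Function.Surjective π) {x : S} (hker : RingHom.ker π = Ideal.span {x})
  {g : ℕ} {c : Fin g → S}
include hπ hker

lemma weaklyRegularMod_cons_of_map (nx : NzdMod ⊥ x)
    (w : WeaklyRegularMod ⊥ (List.ofFn (π ∘ c))) : WeaklyRegularMod ⊥ (x :: List.ofFn c) := by
  refine ⟨nx, ?_⟩
  rw [bot_sup_eq, ← hker, RingHom.ker_eq_comap_bot, weaklyRegularMod_comap_iff hπ, List.map_ofFn]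
  exact w

variable [IsLocalRing S] [IsNoetherianRing S]

lemma weaklyRegularMod_map (hc : ∀ i, c i ∈ maximalIdeal S) (w : WeaklyRegularMod ⊥ (List.ofFn c))
    (nc : NzdMod (Ideal.span (Set.range c)) x) : WeaklyRegularMod ⊥ (List.ofFn (π ∘ c)) := by
  have h : WeaklyRegularMod ⊥ (List.ofFn c ++ [x]) := by
    rw [weaklyRegularMod_append, bot_sup_eq, ofList_ofFn]
    exact ⟨w, nc, trivial⟩
  have h2 := (h.unrotate (by
    intro y hy
    obtain ⟨i, rfl⟩ := (List.mem_ofFn' c y).1 hy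
    exact hc i)).2
  rwa [bot_sup_eq, ← hker, RingHom.ker_eq_comap_bot, weaklyRegularMod_comap_iff hπ,
    List.map_ofFn] at h2

variable (hx : x ∈ maximalIdeal S)
include hx

lemma weaklyRegularMod_of_map (nx : NzdMod ⊥ x) (w : WeaklyRegularMod ⊥ (List.ofFn (π ∘ c))) :
    WeaklyRegularMod ⊥ (List.ofFn c) ∧ NzdMod (Ideal.span (Set.range c)) x := by
  have h := (weaklyRegularMod_cons_of_map hπ hker nx w).rotate hx
  rw [weaklyRegularMod_append, bot_sup_eq, ofList_ofFn] at h
  exact ⟨h.1, h.2.1⟩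

variable [IsLocalRing R] [IsNoetherianRing R] {n : ℕ} (hR : GorensteinOfDim R (g + n))
include hR

lemma map_colon_of_deformation {L : Ideal S} (hL : GradeDepth g n (L.map π)) (nL : NzdMod L x)
    (hc : ∀ i, c i ∈ L) (nc : NzdMod (Ideal.span (Set.range c)) x)
    (w : WeaklyRegularMod ⊥ (List.ofFn (π ∘ c))) :
    ((Ideal.span (Set.range c)).colon (L : Set S)).map π =
      (Ideal.span (Set.range (π ∘ c))).colon ((L.map π : Ideal R) : Set R) := by
  obtain ⟨k, f, hf⟩ := Submodule.fg_iff_exists_fin_generating_family.1 (IsNoetherian.noetherian L)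
  have hcL : Ideal.span (Set.range c) ⊔ Ideal.span (Set.range f) = L := by
    rw [Ideal.span, Ideal.span, hf, sup_eq_right]
    exact Ideal.span_le.2 (by rintro _ ⟨i, rfl⟩; exact hc i)
  have h1 : ExtensionProperty (Ideal.span (Set.range (π ∘ c))) (π ∘ f) := by
    rw [← ofList_ofFn]
    refine hL.extensionProperty hR (by simp) ?_ w _ ?_
    · intro y hy
      obtain ⟨i, rfl⟩ := (List.mem_ofFn' _ y).1 hy
      exact Ideal.mem_map_of_mem _ (hc i)
    · rw [← hf, ← Ideal.span, Ideal.map_span, Set.range_comp]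
  have h2 := h1.comap hπ
  have hcomap : (Ideal.span (Set.range (π ∘ c))).comap π =
      Ideal.span (Set.range c) ⊔ Ideal.span {x} := by
    rw [Set.range_comp, ← Ideal.map_span, Ideal.comap_map_of_surjective _ hπ,
      ← RingHom.ker_eq_comap_bot, hker]
  rw [hcomap] at h2
  have h3 := h2.of_sup_span hx nc (by rwa [hcL])
  ext u
  obtain ⟨u, rfl⟩ := hπ u
  rw [Ideal.mem_map_iff_of_surjective _ hπ]
  constructor
  · rintro ⟨v, hv, hvu⟩
    rw [← hvu, mem_colon_ideal]
    intro s hs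
    obtain ⟨s', hs', rfl⟩ := (Ideal.mem_map_iff_of_surjective _ hπ).1 hs
    rw [← map_mul, Set.range_comp, ← Ideal.map_span]
    exact Ideal.mem_map_of_mem _ (mem_colon_ideal.1 hv s' hs')
  · intro hu
    obtain ⟨a, ha⟩ := h3.colon_sup_span nc (u := u) (by
      intro i
      rw [← hcomap, Ideal.mem_comap, map_mul]
      refine mem_colon_ideal.1 hu _ (Ideal.mem_map_of_mem _ ?_)
      rw [← hf]
      exact Submodule.subset_span ⟨i, rfl⟩)
    refine ⟨u - x * a, ?_, ?_⟩
    · rw [← mem_colon_sup_span_range, hcL] at ha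
      exact ha
    · have : π x = 0 := by
        rw [← RingHom.mem_ker, hker]; exact Ideal.mem_span_singleton_self x
      simp [this]

lemma LinkChain.of_map (nx : NzdMod ⊥ x) (t : ℕ) {L : Ideal S}
    (hL : L.map π = ⊤ ∨ GradeDepth g n (L.map π)) (nL : NzdMod L x)
    (h : LinkChain g t (L.map π)) : LinkChain g t L := by
  have htop : ∀ L : Ideal S, L.map π = ⊤ → L = ⊤ := by
    intro L h1
    by_contra hne
    have h2 : L ⊔ Ideal.span {x} = ⊤ := by
      rw [← hker, RingHom.ker_eq_comap_bot, ← Ideal.comap_map_of_surjective _ hπ, h1,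
        Ideal.comap_top]
    refine (maximalIdeal.isMaximal S).ne_top (top_le_iff.1 (h2 ▸ sup_le (le_maximalIdeal hne) ?_))
    rwa [Ideal.span_singleton_le_iff_mem]
  rcases hL with hL | hL
  · rw [htop L hL]; exact LinkChain.top g t
  induction t generalizing L with
  | zero => exact htop L h
  | succ t ih =>
    obtain h | ⟨c, hc, wc, h⟩ := h
    · exact absurd h hL.1
    choose b hb hbc using fun i => (Ideal.mem_map_iff_of_surjective _ hπ).1 (hc i)
    obtain rfl : π ∘ b = c := funext hbc
    obtain ⟨wb, nb⟩ := weaklyRegularMod_of_map hπ hker hx nx wc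
    refine Or.inr ⟨b, hb, wb, ?_⟩
    rw [← map_colon_of_deformation hπ hker hx hR hL nL hb nb wc] at h
    have hgood := hL.colon hR (cs := List.ofFn (π ∘ b)) (by simp) (by
      intro y hy
      obtain ⟨i, rfl⟩ := (List.mem_ofFn' _ y).1 hy
      exact hc i) wc
    rw [ofList_ofFn, ← map_colon_of_deformation hπ hker hx hR hL nL hb nb wc] at hgood
    rcases hgood with h1 | h1
    · rw [htop _ h1]; exact LinkChain.top g t
    · exact ih (nb.colon L) h h1

end Deformation

section ScaledSequences

variable {R : Type*} [CommRing R]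

lemma NzdMod.of_associated {K : Ideal R} {r s : R} (h : NzdMod K r) (hrs : Associated r s) :
    NzdMod K s := by
  obtain ⟨u, rfl⟩ := hrs
  intro v hv
  have := h _ (by rwa [mul_assoc] at hv)
  exact (Ideal.unit_mul_mem_iff_mem K u.isUnit).1 this

lemma WeaklyRegularMod.of_associated {K : Ideal R} {xs ys : List R} (h : WeaklyRegularMod K xs)
    (hxy : List.Forall₂ Associated xs ys) : WeaklyRegularMod K ys := by
  induction hxy generalizing K with
  | nil => trivial
  | cons h1 _ ih =>
    refine ⟨h.1.of_associated h1, ih ?_⟩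
    obtain ⟨u, rfl⟩ := h1
    rw [Ideal.span_singleton_mul_right_unit u.isUnit]
    exact h.2

end ScaledSequences

section OneVariable

open Polynomial

lemma nzdMod_map_C {R : Type*} [CommRing R] (I : Ideal R) {p : R[X]} (hp : p.Monic) :
    NzdMod (I.map (C : R →+* R[X])) p := by
  intro u hu
  have hI : I.map (C : R →+* R[X]) = RingHom.ker (mapRingHom (Ideal.Quotient.mk I)) := by
    rw [ker_mapRingHom, Ideal.mk_ker]
  rw [hI, RingHom.mem_ker, map_mul] at hu
  rw [hI, RingHom.mem_ker]
  exact ((hp.map (Ideal.Quotient.mk I)).mul_right_eq_zero_iff).1 hu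

variable {R : Type*} [CommRing R] [IsLocalRing R]

/-- The maximal ideal of `R[X]` consisting of the polynomials whose value at `a` is not a unit. -/
noncomputable abbrev evalPrime (a : R) : Ideal R[X] := (maximalIdeal R).comap (evalRingHom a)

/-- The localization of `R[X]` at the polynomials whose value at `a` is a unit. -/
noncomputable abbrev EvalLocalization (a : R) : Type _ := Localization.AtPrime (evalPrime a)

lemma isUnit_evalRingHom {a : R} (p : (evalPrime a).primeCompl) : IsUnit (evalRingHom a p) :=
  of_not_not p.2

/-- Evaluation at `a`. -/
noncomputable def evalLocalization (a : R) : EvalLocalization a →+* R :=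
  IsLocalization.lift (M := (evalPrime a).primeCompl) isUnit_evalRingHom

lemma evalLocalization_algebraMap {a : R} (p : R[X]) :
    evalLocalization a (algebraMap R[X] (EvalLocalization a) p) = p.eval a :=
  IsLocalization.lift_eq _ p

lemma evalLocalization_surjective (a : R) : Function.Surjective (evalLocalization a) :=
  fun r => ⟨algebraMap R[X] _ (C r), by rw [evalLocalization_algebraMap, eval_C]⟩

lemma map_evalLocalization {a : R} (K : Ideal R[X]) :
    (K.map (algebraMap R[X] (EvalLocalization a))).map (evalLocalization a) =
      K.map (evalRingHom a) := by
  rw [Ideal.map_map]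
  congr 1
  exact RingHom.ext evalLocalization_algebraMap

lemma ker_evalLocalization (a : R) : RingHom.ker (evalLocalization a) =
    Ideal.span {algebraMap R[X] (EvalLocalization a) (X - C a)} := by
  refine le_antisymm (fun s hs => ?_) ?_
  · obtain ⟨p, q, rfl⟩ := IsLocalization.exists_mk'_eq (evalPrime a).primeCompl s
    have h1 : evalLocalization a (algebraMap R[X] (EvalLocalization a) p) = 0 := by
      rw [← IsLocalization.mk'_spec (EvalLocalization a) p q, map_mul, RingHom.mem_ker.1 hs,
        zero_mul]
    rw [evalLocalization_algebraMap] at h1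
    obtain ⟨r, rfl⟩ := dvd_iff_isRoot.2 h1
    exact Ideal.mem_span_singleton.2 ⟨_, (IsLocalization.mul_mk'_eq_mk'_of_mul _ _ _).symm⟩
  · rw [Ideal.span_singleton_le_iff_mem, RingHom.mem_ker, evalLocalization_algebraMap]
    simp

lemma sub_mem_maximalIdeal (a : R) :
    algebraMap R[X] (EvalLocalization a) (X - C a) ∈ maximalIdeal (EvalLocalization a) := by
  rw [IsLocalization.AtPrime.to_map_mem_maximal_iff _ (evalPrime a)]
  simp

variable {B : Type*} [CommRing B] [Algebra R[X] B]
  [IsLocalization.AtPrime B ((maximalIdeal R).map (C : R →+* R[X]))]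

lemma map_C_le_evalPrime (a : R) : (maximalIdeal R).map (C : R →+* R[X]) ≤ evalPrime a := by
  rw [Ideal.map_le_iff_le_comap]
  intro r hr
  simpa using hr

variable (B) in
/-- The localization map from the localization at the values at `a` to `R(X)`. -/
noncomputable def toUniversal (a : R) : EvalLocalization a →+* B :=
  IsLocalization.lift (M := (evalPrime a).primeCompl) (g := algebraMap R[X] B) fun p =>
    IsLocalization.map_units (M := ((maximalIdeal R).map (C : R →+* R[X])).primeCompl) B
      ⟨p, fun h => p.2 (map_C_le_evalPrime a h)⟩

lemma toUniversal_algebraMap {a : R} (p : R[X]) :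
    toUniversal B a (algebraMap R[X] (EvalLocalization a) p) = algebraMap R[X] B p :=
  IsLocalization.lift_eq _ p

lemma isUnit_algebraMap_sub (a : R) : IsUnit (algebraMap R[X] B (X - C a)) := by
  refine IsLocalization.map_units (M := ((maximalIdeal R).map (C : R →+* R[X])).primeCompl) B
      ⟨X - C a, fun h => ?_⟩
  have := Ideal.mem_map_C_iff.1 h 1
  simp at this

lemma flat_toUniversal (a : R) : (toUniversal B a).Flat := by
  algebraize [toUniversal B a]
  have : IsScalarTower R[X] (EvalLocalization a) B :=
    IsScalarTower.of_algebraMap_eq fun p => (toUniversal_algebraMap p).symm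
  have := IsLocalization.isLocalization_of_submonoid_le (EvalLocalization a) B
    (evalPrime a).primeCompl ((maximalIdeal R).map (C : R →+* R[X])).primeCompl
    fun p hp h => hp (map_C_le_evalPrime a h)
  exact IsLocalization.flat B ((((maximalIdeal R).map (C : R →+* R[X])).primeCompl).map
    (algebraMap R[X] (EvalLocalization a)))

variable [IsNoetherianRing R]

lemma exists_contraction (K : Ideal R[X]) :
    ∃ h ∉ (maximalIdeal R).map (C : R →+* R[X]), ∀ a : R, h.eval a ∉ maximalIdeal R →
      ∀ w : EvalLocalization a, toUniversal B a w ∈ K.map (algebraMap R[X] B) →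
        w ∈ K.map (algebraMap R[X] (EvalLocalization a)) := by
  have hfg := IsNoetherian.noetherian ((K.map (algebraMap R[X] B)).comap (algebraMap R[X] B))
  have key : ∃ h ∉ (maximalIdeal R).map (C : R →+* R[X]),
      ∀ u : R[X], algebraMap R[X] B u ∈ K.map (algebraMap R[X] B) → h * u ∈ K := by
    obtain ⟨S, hS⟩ := hfg
    have h1 : ∀ s ∈ S, ∃ h ∈ ((maximalIdeal R).map (C : R →+* R[X])).primeCompl, h * s ∈ K := by
      intro s hs
      rw [← IsLocalization.algebraMap_mem_map_algebraMap_iff _ B, ← Ideal.mem_comap, ← hS]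
      exact Submodule.subset_span hs
    choose! h h2 h3 using h1
    refine ⟨∏ s ∈ S, h s, prod_mem h2, fun u hu => ?_⟩
    rw [← Ideal.mem_comap, ← hS] at hu
    suffices Submodule.span R[X] (S : Set R[X]) ≤ K.colon {∏ s ∈ S, h s} by
      simpa [Submodule.mem_colon_singleton, mul_comm] using this hu
    rw [Submodule.span_le]
    intro s hs
    rw [SetLike.mem_coe, Submodule.mem_colon_singleton, smul_eq_mul, mul_comm]
    exact K.mem_of_dvd (mul_dvd_mul_right (Finset.dvd_prod_of_mem h hs) s) (h3 s hs)
  obtain ⟨h, h1, h2⟩ := key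
  refine ⟨h, h1, fun a ha w hw => ?_⟩
  obtain ⟨p, q, rfl⟩ := IsLocalization.exists_mk'_eq (evalPrime a).primeCompl w
  have h3 : algebraMap R[X] B p ∈ K.map (algebraMap R[X] B) := by
    rw [← toUniversal_algebraMap (a := a), ← IsLocalization.mk'_spec (EvalLocalization a) p q,
      map_mul]
    exact Ideal.mul_mem_right _ _ hw
  rw [IsLocalization.mem_map_algebraMap_iff (evalPrime a).primeCompl]
  refine ⟨(⟨h * p, h2 _ h3⟩, ⟨h, ha⟩ * q), ?_⟩
  rw [Submonoid.coe_mul, map_mul, mul_left_comm, IsLocalization.mk'_spec, map_mul]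

lemma exists_nzdMod (K : Ideal R[X]) :
    ∃ h ∉ (maximalIdeal R).map (C : R →+* R[X]), ∀ a : R, h.eval a ∉ maximalIdeal R →
      ∀ w : EvalLocalization a, NzdMod (K.map (algebraMap R[X] B)) (toUniversal B a w) →
        NzdMod (K.map (algebraMap R[X] (EvalLocalization a))) w := by
  obtain ⟨h, h1, h2⟩ := exists_contraction (B := B) K
  refine ⟨h, h1, fun a ha w hw u hu => h2 a ha u (hw _ ?_)⟩
  rw [← map_mul]
  have := Ideal.mem_map_of_mem (toUniversal B a) hu
  rw [Ideal.map_map] at this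
  convert this
  exact (RingHom.ext toUniversal_algebraMap).symm

lemma exists_weaklyRegularMod (K : Ideal R[X]) (cs : List R[X])
    (w : WeaklyRegularMod (K.map (algebraMap R[X] B)) (cs.map (algebraMap R[X] B))) :
    ∃ h ∉ (maximalIdeal R).map (C : R →+* R[X]), ∀ a : R, h.eval a ∉ maximalIdeal R →
      WeaklyRegularMod (K.map (algebraMap R[X] (EvalLocalization a)))
        (cs.map (algebraMap R[X] (EvalLocalization a))) := by
  induction cs generalizing K with
  | nil => exact ⟨1, (Ideal.ne_top_iff_one _).1 (Ideal.IsPrime.ne_top inferInstance),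
      fun _ _ => trivial⟩
  | cons c cs ih =>
    obtain ⟨h, h1, h2⟩ := exists_nzdMod (B := B) K
    obtain ⟨h', h3, h4⟩ := ih (K ⊔ Ideal.span {c}) (by
      rw [Ideal.map_sup, Ideal.map_span, Set.image_singleton]; exact w.2)
    refine ⟨h * h', fun hh => (Ideal.IsPrime.mem_or_mem inferInstance hh).elim h1 h3,
      fun a ha => ?_⟩
    rw [eval_mul] at ha
    refine ⟨h2 a (fun hh => ha (Ideal.mul_mem_right _ _ hh)) _ ?_, ?_⟩
    · rw [toUniversal_algebraMap]; exact w.1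
    · have := h4 a (fun hh => ha (Ideal.mul_mem_left _ _ hh))
      rwa [Ideal.map_sup, Ideal.map_span, Set.image_singleton] at this

end OneVariable

section OneVariableDescent

open Polynomial

variable {R : Type*} [CommRing R] [IsLocalRing R] {g n : ℕ}

/-- The values at `a` of the polynomials in `K` form the unit ideal or a Cohen-Macaulay ideal, and
`X - a` is a nonzerodivisor modulo `K` locally. -/
def GoodSpecialization (g n : ℕ) (K : Ideal R[X]) (a : R) : Prop :=
  (K.map (evalRingHom a) = ⊤ ∨ GradeDepth g n (K.map (evalRingHom a))) ∧
    NzdMod (K.map (algebraMap R[X] (EvalLocalization a)))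
      (algebraMap R[X] (EvalLocalization a) (X - C a))

variable (B : Type*) [CommRing B] [Algebra R[X] B]
  [IsLocalization.AtPrime B ((maximalIdeal R).map (C : R →+* R[X]))]

lemma exists_map_evalRingHom_eq_top {K : Ideal R[X]} (h : K.map (algebraMap R[X] B) = ⊤) :
    ∃ h ∉ (maximalIdeal R).map (C : R →+* R[X]), ∀ a : R, h.eval a ∉ maximalIdeal R →
      K.map (evalRingHom a) = ⊤ := by
  obtain ⟨h, h1, h2⟩ := Set.not_disjoint_iff.1 fun hd =>
    (IsLocalization.map_algebraMap_ne_top_iff_disjoint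
      ((maximalIdeal R).map (C : R →+* R[X])).primeCompl B K).2 hd h
  exact ⟨h, h1, fun a ha => Ideal.eq_top_of_isUnit_mem _ (Ideal.mem_map_of_mem (evalRingHom a) h2)
    (of_not_not ha)⟩

variable [IsNoetherianRing R]

lemma exists_linkChain_specialization (hR : GorensteinOfDim R (g + n)) (t : ℕ) (K : Ideal R[X])
    (hK : LinkChain g t (K.map (algebraMap R[X] B))) :
    ∃ h ∉ (maximalIdeal R).map (C : R →+* R[X]), ∀ a : R, h.eval a ∉ maximalIdeal R →
      GoodSpecialization g n K a → LinkChain g t (K.map (evalRingHom a)) := by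
  induction t generalizing K with
  | zero =>
    obtain ⟨h, h1, h2⟩ := exists_map_evalRingHom_eq_top B hK
    exact ⟨h, h1, fun a ha _ => h2 a ha⟩
  | succ t ih =>
    obtain hK | ⟨b, hb, wb, hK⟩ := hK
    · obtain ⟨h, h1, h2⟩ := exists_map_evalRingHom_eq_top B hK
      exact ⟨h, h1, fun a ha _ => by rw [h2 a ha]; exact LinkChain.top _ _⟩
    have h0 : ∀ i, ∃ c ∈ K, Associated (b i) (algebraMap R[X] B c) := by
      intro i
      obtain ⟨⟨c, s⟩, h1⟩ := (IsLocalization.mem_map_algebraMap_iff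
        ((maximalIdeal R).map (C : R →+* R[X])).primeCompl B).1 (hb i)
      exact ⟨c, c.2, (IsLocalization.map_units B s).unit, h1⟩
    choose c hc hbc using h0
    have wc : WeaklyRegularMod ⊥ (List.ofFn (algebraMap R[X] B ∘ c)) := by
      refine wb.of_associated ?_
      rw [List.forall₂_iff_get]
      exact ⟨by simp, fun i h1 h2 => by simpa using hbc _⟩
    have hspan : Ideal.span (Set.range b) =
        (Ideal.span (Set.range c)).map (algebraMap R[X] B) := by
      rw [Ideal.map_span, ← Set.range_comp]
      refine le_antisymm (Ideal.span_le.2 ?_) (Ideal.span_le.2 ?_)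
      · rintro _ ⟨i, rfl⟩
        exact Ideal.mem_of_dvd _ (hbc i).symm.dvd (Ideal.subset_span ⟨i, rfl⟩)
      · rintro _ ⟨i, rfl⟩
        exact Ideal.mem_of_dvd _ (hbc i).dvd (Ideal.subset_span ⟨i, rfl⟩)
    have := IsLocalization.flat B ((maximalIdeal R).map (C : R →+* R[X])).primeCompl
    rw [hspan, ← map_colon_of_flat] at hK
    obtain ⟨h1, hh1, hh1'⟩ := ih _ hK
    obtain ⟨h2, hh2, hh2'⟩ := exists_weaklyRegularMod (B := B) ⊥ (List.ofFn c)
      (by rwa [Ideal.map_bot, List.map_ofFn])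
    obtain ⟨h3, hh3, hh3'⟩ := exists_nzdMod (B := B) (Ideal.span (Set.range c))
    refine ⟨h1 * h2 * h3, fun hh => ?_, fun a ha hgood => ?_⟩
    · rcases Ideal.IsPrime.mem_or_mem inferInstance hh with hh | hh
      · exact (Ideal.IsPrime.mem_or_mem inferInstance hh).elim hh1 hh2
      · exact hh3 hh
    rw [eval_mul, eval_mul] at ha
    have ha1 : h1.eval a ∉ maximalIdeal R := fun hh =>
      ha (Ideal.mul_mem_right _ _ (Ideal.mul_mem_right _ _ hh))
    have ha2 : h2.eval a ∉ maximalIdeal R := fun hh =>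
      ha (Ideal.mul_mem_right _ _ (Ideal.mul_mem_left _ _ hh))
    have ha3 : h3.eval a ∉ maximalIdeal R := fun hh => ha (Ideal.mul_mem_left _ _ hh)
    obtain ⟨hL | hL, nL⟩ := hgood
    · rw [hL]; exact LinkChain.top _ _
    have w := hh2' a ha2
    rw [Ideal.map_bot, List.map_ofFn] at w
    have nc := hh3' a ha3 (algebraMap R[X] (EvalLocalization a) (X - C a)) (by
      rw [toUniversal_algebraMap]
      exact NzdMod.of_isUnit _ (isUnit_algebraMap_sub a))
    rw [Ideal.map_span, ← Set.range_comp] at nc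
    have hcL : ∀ i, (algebraMap R[X] (EvalLocalization a) ∘ c) i ∈
        K.map (algebraMap R[X] (EvalLocalization a)) := fun i => Ideal.mem_map_of_mem _ (hc i)
    rw [← map_evalLocalization] at hL
    have hne : K.map (algebraMap R[X] (EvalLocalization a)) ≠ ⊤ := by
      intro hh
      rw [hh, Ideal.map_top] at hL
      exact hL.1 rfl
    have hN : IsNoetherianRing (EvalLocalization a) :=
      IsLocalization.isNoetherianRing (evalPrime a).primeCompl _ inferInstance
    have hsurj := evalLocalization_surjective a
    have hker := ker_evalLocalization a
    have w' := weaklyRegularMod_map hsurj hker (fun i => le_maximalIdeal hne (hcL i)) w nc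
    have hcol := map_colon_of_deformation hsurj hker (sub_mem_maximalIdeal a) hR hL nL hcL nc w'
    have hgood := hL.colon hR (cs := List.ofFn (evalLocalization a ∘ (algebraMap R[X] _ ∘ c)))
      (by simp) (by
        intro y hy
        obtain ⟨i, rfl⟩ := (List.mem_ofFn' _ y).1 hy
        exact Ideal.mem_map_of_mem _ (hcL i)) w'
    have hflat := IsLocalization.flat (EvalLocalization a) (evalPrime a).primeCompl
    have hcolS := map_colon_of_flat (B := EvalLocalization a) (Ideal.span (Set.range c)) K
    rw [Ideal.map_span, ← Set.range_comp] at hcolS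
    rw [← map_evalLocalization]
    refine Or.inr ⟨_, fun i => Ideal.mem_map_of_mem _ (hcL i), w', ?_⟩
    change LinkChain g t ((Ideal.span (Set.range (evalLocalization a ∘ _))).colon _)
    rw [ofList_ofFn, ← hcol, ← hcolS, map_evalLocalization] at hgood
    rw [← hcol, ← hcolS, map_evalLocalization]
    refine hh1' a ha1 ⟨hgood, ?_⟩
    rw [hcolS]
    exact nc.colon _

end OneVariableDescent

section OneVariableLinks

open Polynomial

lemma map_C_map_evalRingHom {R : Type*} [CommRing R] (I : Ideal R) (a : R) : (I.map C).map (evalRingHom a) = I := by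
  rw [Ideal.map_map]
  convert Ideal.map_id I
  ext r
  simp

lemma map_map_C_universal {R : Type*} [CommRing R] (B : Type*) [CommRing B] [Algebra R B]
    [Algebra R[X] B] [IsScalarTower R R[X] B] (I : Ideal R) :
    (I.map C).map (algebraMap R[X] B) = I.map (algebraMap R B) := by
  rw [Ideal.map_map, IsScalarTower.algebraMap_eq R R[X] B]
  rfl

lemma exists_eval_notMem {R : Type*} [CommRing R] [IsLocalRing R]
    [Infinite (ResidueField R)] {h : R[X]}
    (hh : h ∉ (maximalIdeal R).map (C : R →+* R[X])) : ∃ a : R, h.eval a ∉ maximalIdeal R := by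
  by_contra! hcon
  refine hh (Ideal.mem_map_C_iff.2 fun k => ?_)
  have h0 : h.map (residue R) = 0 := by
    refine Polynomial.eq_zero_of_infinite_isRoot _ (Set.infinite_univ.mono fun b _ => ?_)
    obtain ⟨a, rfl⟩ := residue_surjective b
    rw [Set.mem_ofPred_eq, IsRoot, eval_map_apply, residue_eq_zero_iff]
    exact hcon a
  rw [← residue_eq_zero_iff, ← coeff_map, h0, coeff_zero]

variable {R : Type*} [CommRing R] [IsLocalRing R] [IsNoetherianRing R] {g n : ℕ}

lemma goodSpecialization_map_C {I : Ideal R} (hI : I = ⊤ ∨ GradeDepth g n I) (a : R) :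
    GoodSpecialization g n (I.map C) a := by
  refine ⟨by rwa [map_C_map_evalRingHom], ?_⟩
  have := IsLocalization.flat (EvalLocalization a) (evalPrime a).primeCompl
  exact (nzdMod_map_C I (monic_X_sub_C a)).map (IsNoetherian.noetherian _)

variable (B : Type*) [CommRing B] [Algebra R B] [Algebra R[X] B] [IsScalarTower R R[X] B]
  [IsLocalization.AtPrime B ((maximalIdeal R).map (C : R →+* R[X]))]

lemma LinkChain.of_map_oneVariable [Infinite (ResidueField R)] (hR : GorensteinOfDim R (g + n))
    {t : ℕ} {I : Ideal R} (hI : I = ⊤ ∨ GradeDepth g n I)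
    (h : LinkChain g t (I.map (algebraMap R B))) : LinkChain g t I := by
  rw [← map_map_C_universal] at h
  obtain ⟨p, hp, hp'⟩ := exists_linkChain_specialization B hR t _ h
  obtain ⟨a, ha⟩ := exists_eval_notMem hp
  have := hp' a ha (goodSpecialization_map_C hI a)
  rwa [map_C_map_evalRingHom] at this

lemma linkChain_colon_oneVariable (hR : GorensteinOfDim R (g + n)) {I : Ideal R}
    (hI : GradeDepth g n I) {c v : Fin g → R} (hc : ∀ i, c i ∈ I) (hv : ∀ i, v i ∈ I)
    (wc : WeaklyRegularMod ⊥ (List.ofFn c)) (a : R) {β : Fin g → B}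
    (hβ : ∀ i, β i = algebraMap R B (c i) + algebraMap R[X] B (X - C a) * algebraMap R B (v i)) :
    WeaklyRegularMod ⊥ (List.ofFn β) ∧
      ∀ t, LinkChain g t ((Ideal.span (Set.range c)).colon (I : Set R)) →
        LinkChain g t ((Ideal.span (Set.range β)).colon
          ((I.map (algebraMap R B) : Ideal B) : Set B)) := by
  have hN : IsNoetherianRing (EvalLocalization a) :=
    IsLocalization.isNoetherianRing (evalPrime a).primeCompl _ inferInstance
  have hsurj := evalLocalization_surjective a
  have hker := ker_evalLocalization a
  have hx := sub_mem_maximalIdeal a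
  set x := algebraMap R[X] (EvalLocalization a) (X - C a) with hxdef
  set L := (I.map C).map (algebraMap R[X] (EvalLocalization a)) with hLdef
  have hLI : L.map (evalLocalization a) = I := by
    rw [hLdef, map_evalLocalization, map_C_map_evalRingHom]
  have hflat := IsLocalization.flat (EvalLocalization a) (evalPrime a).primeCompl
  have nL : NzdMod L x := (goodSpecialization_map_C (Or.inr hI) a).2
  have nx : NzdMod ⊥ x := by
    have := (nzdMod_map_C (⊥ : Ideal R) (monic_X_sub_C a)).map (B := EvalLocalization a)
      (IsNoetherian.noetherian _)
    rwa [Ideal.map_bot, Ideal.map_bot] at this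
  set γ : Fin g → EvalLocalization a := fun i =>
    algebraMap R[X] _ (C (c i)) + x * algebraMap R[X] _ (C (v i)) with hγ
  have hmem : ∀ r ∈ I, algebraMap R[X] (EvalLocalization a) (C r) ∈ L := fun r hr =>
    Ideal.mem_map_of_mem _ (Ideal.mem_map_of_mem _ hr)
  have hγL : ∀ i, γ i ∈ L := fun i =>
    add_mem (hmem _ (hc i)) (Ideal.mul_mem_left _ _ (hmem _ (hv i)))
  have hγc : evalLocalization a ∘ γ = c := by
    ext i
    simp [hγ, hxdef, evalLocalization_algebraMap]
  have hγβ : toUniversal B a ∘ γ = β := by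
    ext i
    simp only [hγ, hxdef, Function.comp_apply, map_add, map_mul, toUniversal_algebraMap, hβ]
    rw [IsScalarTower.algebraMap_apply R R[X] B, IsScalarTower.algebraMap_apply R R[X] B]
    rfl
  have hLB : L.map (toUniversal B a) = I.map (algebraMap R B) := by
    rw [hLdef, Ideal.map_map, ← map_map_C_universal B I]
    congr 1
    exact RingHom.ext toUniversal_algebraMap
  have wc' : WeaklyRegularMod ⊥ (List.ofFn (evalLocalization a ∘ γ)) := by rwa [hγc]
  obtain ⟨wγ, nγ⟩ := weaklyRegularMod_of_map hsurj hker hx nx wc'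
  have hcol := map_colon_of_deformation hsurj hker hx hR (by rwa [hLI]) nL hγL nγ wc'
  rw [hγc, hLI] at hcol
  have hgood := hI.colon hR (cs := List.ofFn c) (by simp) (by
    intro y hy
    obtain ⟨i, rfl⟩ := (List.mem_ofFn' _ y).1 hy
    exact hc i) wc
  rw [ofList_ofFn, ← hcol] at hgood
  have hfl := flat_toUniversal (B := B) a
  algebraize [toUniversal B a]
  have hmapγ : (Ideal.span (Set.range γ)).map (algebraMap (EvalLocalization a) B) =
      Ideal.span (Set.range β) := by
    rw [Ideal.map_span, ← Set.range_comp, ← hγβ]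
    rfl
  refine ⟨?_, fun t h => ?_⟩
  · have := wγ.map (B := B)
    rw [Ideal.map_bot, List.map_ofFn] at this
    rwa [← hγβ]
  · have h1 := LinkChain.of_map hsurj hker hx hR nx t hgood (nγ.colon _) (by rwa [hcol])
    have h2 := h1.map (B := B)
    rw [map_colon_of_flat, hmapγ] at h2
    rwa [← hLB]

end OneVariableLinks

section NagataExtension

open MvPolynomial

instance isPrime_map_C_mvPolynomial {σ R : Type*} [CommRing R] (P : Ideal R) [P.IsPrime] :
    (P.map (C : R →+* MvPolynomial σ R)).IsPrime := by
  have h : P.map (C : R →+* MvPolynomial σ R) = RingHom.ker (map (Ideal.Quotient.mk P)) := by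
    rw [ker_map, Ideal.mk_ker]
  rw [h]
  exact RingHom.ker_isPrime _

/-- The ring homomorphism `φ` is the localization map at the prime ideal `Q`. -/
def IsLocalizationHom {T B : Type*} [CommRing T] [CommRing B] (φ : T →+* B) (Q : Ideal T)
    [Q.IsPrime] : Prop :=
  @IsLocalization.AtPrime T _ B _ φ.toAlgebra Q _

lemma IsLocalizationHom.comp_ringEquiv {T T' B : Type*} [CommRing T] [CommRing T'] [CommRing B]
    {φ : T →+* B} {Q : Ideal T} [Q.IsPrime] (h : IsLocalizationHom φ Q) (e : T ≃+* T')
    {Q' : Ideal T'} [Q'.IsPrime] (hQ : Q.map (e : T →+* T') = Q') :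
    IsLocalizationHom (φ.comp (e.symm : T' →+* T)) Q' := by
  let := φ.toAlgebra
  have h : IsLocalization Q.primeCompl B := h
  have h1 := IsLocalization.isLocalization_of_base_ringEquiv Q.primeCompl B e
  have h2 : Q.primeCompl.map (e : T →* T') = Q'.primeCompl := by
    ext y
    obtain ⟨x, rfl⟩ := e.surjective y
    have : e x ∈ Q' ↔ x ∈ Q := by
      rw [← hQ]
      exact ⟨fun hx => by
        obtain ⟨z, hz, hz'⟩ := (Ideal.mem_map_iff_of_surjective _ e.surjective).1 hx
        rwa [← e.injective hz'], fun hx => Ideal.mem_map_of_mem (e : T →+* T') hx⟩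
    simp only [Submonoid.mem_map, Ideal.mem_primeCompl_iff, this]
    exact ⟨fun ⟨z, hz, hz'⟩ => by rwa [← e.injective hz'], fun hx => ⟨x, hx, rfl⟩⟩
  unfold IsLocalizationHom IsLocalization.AtPrime
  rw [← h2]
  exact h1

variable {σ : Type*} {R B : Type*} [CommRing R] [IsLocalRing R] [CommRing B]

/-- The ring homomorphism `φ` identifies `B` with the localization of the polynomial ring at the
polynomials with a unit coefficient. -/
def IsNagataExtension (φ : MvPolynomial σ R →+* B) : Prop :=
  IsLocalizationHom φ ((maximalIdeal R).map C)

lemma IsNagataExtension.rename {τ : Type*} {φ : MvPolynomial τ R →+* B} (h : IsNagataExtension φ)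
    (e : σ ≃ τ) :
    IsNagataExtension (φ.comp ((renameEquiv R e : MvPolynomial σ R ≃ₐ[R] _) :
      MvPolynomial σ R →+* MvPolynomial τ R)) := by
  refine IsLocalizationHom.comp_ringEquiv h (renameEquiv R e).symm.toRingEquiv ?_
  rw [Ideal.map_map]
  congr 1
  ext r
  simp

lemma IsNagataExtension.exists_option {φ : MvPolynomial (Option σ) R →+* B}
    (h : IsNagataExtension φ) :
    ∃ ψ : MvPolynomial σ (Localization.AtPrime
        ((maximalIdeal R).map (Polynomial.C : R →+* Polynomial R))) →+* B,
      IsNagataExtension ψ ∧ (∀ k, ψ (X k) = φ (X (some k))) ∧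
      ψ (C (algebraMap (Polynomial R) _ Polynomial.X)) = φ (X none) ∧
      ψ.comp (C.comp (algebraMap R _)) = φ.comp C := by
  set P := (maximalIdeal R).map (Polynomial.C : R →+* Polynomial R) with hP
  have h1 : IsLocalizationHom (φ.comp ((optionEquivRight R σ).symm.toRingEquiv :
      MvPolynomial σ (Polynomial R) →+* _)) (P.map C) := by
    refine IsLocalizationHom.comp_ringEquiv h (optionEquivRight R σ).toRingEquiv ?_
    rw [hP, Ideal.map_map, Ideal.map_map]
    congr 1
    ext1 r
    exact optionEquivRight_C R σ r
  set χ := φ.comp ((optionEquivRight R σ).symm.toRingEquiv :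
      MvPolynomial σ (Polynomial R) →+* _) with hχ
  let := χ.toAlgebra
  replace h1 : IsLocalization (P.map (C : _ →+* MvPolynomial σ (Polynomial R))).primeCompl B := h1
  let : Algebra (MvPolynomial σ (Polynomial R)) (MvPolynomial σ (Localization.AtPrime P)) :=
    algebraMvPolynomial
  have hle : P.primeCompl.map C ≤
      (P.map (C : _ →+* MvPolynomial σ (Polynomial R))).primeCompl := by
    rintro _ ⟨p, hp, rfl⟩ hp'
    exact hp (by simpa using mem_map_C_iff.1 hp' 0)
  have hmem (p : MvPolynomial σ (Polynomial R)) :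
      algebraMap _ (MvPolynomial σ (Localization.AtPrime P)) p ∈
        (maximalIdeal (Localization.AtPrime P)).map C ↔ p ∈ P.map C := by
    rw [mem_map_C_iff, mem_map_C_iff]
    refine forall_congr' fun k => ?_
    rw [algebraMap_def, coeff_map, IsLocalization.AtPrime.to_map_mem_maximal_iff _ P]
  have hu (y : P.primeCompl.map (C : _ →+* MvPolynomial σ (Polynomial R))) : IsUnit (χ y) :=
    IsLocalization.map_units (M := (P.map (C : _ →+* MvPolynomial σ (Polynomial R))).primeCompl) B
      ⟨y.1, hle y.2⟩
  set ψ : MvPolynomial σ (Localization.AtPrime P) →+* B := IsLocalization.lift hu with hψ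
  have hψ' (p) : ψ (algebraMap (MvPolynomial σ (Polynomial R)) _ p) = χ p :=
    IsLocalization.lift_eq hu p
  refine ⟨ψ, ?_, fun k => ?_, ?_, ?_⟩
  · let := ψ.toAlgebra
    have : IsScalarTower (MvPolynomial σ (Polynomial R))
        (MvPolynomial σ (Localization.AtPrime P)) B :=
      IsScalarTower.of_algebraMap_eq fun p => (hψ' p).symm
    have h2 := IsLocalization.isLocalization_of_submonoid_le
      (MvPolynomial σ (Localization.AtPrime P)) B _ _ hle
    refine IsLocalization.of_le_of_exists_dvd
      ((P.map (C : _ →+* MvPolynomial σ (Polynomial R))).primeCompl.map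
        (algebraMap _ (MvPolynomial σ (Localization.AtPrime P)))) _ ?_ ?_
    · rintro _ ⟨p, hp, rfl⟩ hp'
      exact hp ((hmem p).1 hp')
    · intro q hq
      obtain ⟨⟨p, s⟩, hs⟩ := IsLocalization.surj
        (P.primeCompl.map (C : _ →+* MvPolynomial σ (Polynomial R))) q
      refine ⟨_, ⟨p, fun hp => ?_, rfl⟩, ⟨_, hs.symm⟩⟩
      have := (hmem p).2 hp
      rw [← hs] at this
      exact (Ideal.IsPrime.mem_or_mem inferInstance this).elim hq fun hh => hle s.2 ((hmem _).1 hh)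
  · have := hψ' (X k)
    rw [algebraMap_def, map_X] at this
    rw [this, hχ, ← optionEquivRight_X_some R σ k]
    simp
  · have := hψ' (C Polynomial.X)
    rw [algebraMap_def, map_C] at this
    rw [this, hχ, ← optionEquivRight_X_none R σ]
    simp
  · ext r
    have := hψ' (C (Polynomial.C r))
    rw [algebraMap_def, map_C] at this
    simp only [RingHom.comp_apply]
    rw [IsScalarTower.algebraMap_apply R (Polynomial R) (Localization.AtPrime P)]
    refine this.trans ?_
    rw [hχ, ← optionEquivRight_C R σ]
    simp

lemma IsNagataExtension.bijective [IsEmpty σ] {φ : MvPolynomial σ R →+* B}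
    (h : IsNagataExtension φ) : Function.Bijective (φ.comp C) := by
  let := φ.toAlgebra
  have h : IsLocalization ((maximalIdeal R).map (C : R →+* MvPolynomial σ R)).primeCompl B := h
  have hC : Function.Bijective (C : R →+* MvPolynomial σ R) :=
    ⟨C_injective σ R, C_surjective σ⟩
  rw [RingHom.coe_comp]
  refine Function.Bijective.comp ?_ hC
  refine (IsLocalization.atUnits _ ((maximalIdeal R).map (C : R →+* MvPolynomial σ R)).primeCompl
    ?_ (S := B)).bijective
  intro p hp
  obtain ⟨r, rfl⟩ := hC.2 p
  exact (of_not_not fun hr : ¬ IsUnit r => hp (Ideal.mem_map_of_mem _ hr) : IsUnit r).map C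

lemma IsNagataExtension.flat {φ : MvPolynomial σ R →+* B} (h : IsNagataExtension φ) :
    (φ.comp C).Flat := by
  let := φ.toAlgebra
  have h : IsLocalization ((maximalIdeal R).map (C : R →+* MvPolynomial σ R)).primeCompl B := h
  refine RingHom.Flat.comp ?_ (IsLocalization.flat B
    ((maximalIdeal R).map (C : R →+* MvPolynomial σ R)).primeCompl)
  exact RingHom.flat_algebraMap_iff.2 (inferInstance : Module.Flat R (MvPolynomial σ R))

lemma IsNagataExtension.isNoetherianRing [Finite σ] [IsNoetherianRing R]
    {φ : MvPolynomial σ R →+* B} (h : IsNagataExtension φ) : IsNoetherianRing B := by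
  let := φ.toAlgebra
  have h : IsLocalization ((maximalIdeal R).map (C : R →+* MvPolynomial σ R)).primeCompl B := h
  exact IsLocalization.isNoetherianRing
    ((maximalIdeal R).map (C : R →+* MvPolynomial σ R)).primeCompl B inferInstance

lemma IsNagataExtension.map_maximalIdeal [IsLocalRing B] {φ : MvPolynomial σ R →+* B}
    (h : IsNagataExtension φ) :
    (IsLocalRing.maximalIdeal R).map (φ.comp C) = IsLocalRing.maximalIdeal B := by
  let := φ.toAlgebra
  have h : IsLocalization.AtPrime B
      ((IsLocalRing.maximalIdeal R).map (C : R →+* MvPolynomial σ R)) := h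
  rw [← Ideal.map_map]
  exact IsLocalization.AtPrime.map_eq_maximalIdeal
    ((IsLocalRing.maximalIdeal R).map (C : R →+* MvPolynomial σ R)) B

lemma infinite_residueField {R B : Type*} [CommRing R] [IsLocalRing R] [CommRing B]
    [IsLocalRing B] (φ : R →+* B) (h : (maximalIdeal R).map φ ≤ maximalIdeal B)
    [Infinite (ResidueField R)] : Infinite (ResidueField B) := by
  have : IsLocalHom φ := ((local_hom_TFAE φ).out 0 2).2 h
  exact Infinite.of_injective _ (ResidueField.map φ).injective

end NagataExtension

section OneVariableNagata

variable (R : Type*) [CommRing R] [IsLocalRing R]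

/-- The localization `R(X)` of `R[X]` at the polynomials with a unit coefficient. -/
noncomputable abbrev NagataRing : Type _ :=
  Localization.AtPrime ((maximalIdeal R).map (Polynomial.C : R →+* Polynomial R))

lemma NagataRing.map_maximalIdeal : (IsLocalRing.maximalIdeal R).map (algebraMap R (NagataRing R)) =
    IsLocalRing.maximalIdeal (NagataRing R) := by
  rw [← map_map_C_universal]
  exact IsLocalization.AtPrime.map_eq_maximalIdeal
    ((IsLocalRing.maximalIdeal R).map (Polynomial.C : R →+* Polynomial R)) _

instance : Module.Flat R (NagataRing R) :=
  have := IsLocalization.flat (NagataRing R)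
    ((maximalIdeal R).map (Polynomial.C : R →+* Polynomial R)).primeCompl
  Module.Flat.trans R (Polynomial R) (NagataRing R)

instance [IsNoetherianRing R] : IsNoetherianRing (NagataRing R) :=
  IsLocalization.isNoetherianRing
    ((maximalIdeal R).map (Polynomial.C : R →+* Polynomial R)).primeCompl _ inferInstance

instance [Infinite (ResidueField R)] : Infinite (ResidueField (NagataRing R)) :=
  infinite_residueField (algebraMap R (NagataRing R)) (NagataRing.map_maximalIdeal R).le

variable {R}

lemma GradeDepth.map_nagataRing [IsNoetherianRing R] {g n : ℕ} {I : Ideal R}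
    (hI : I = ⊤ ∨ GradeDepth g n I) :
    I.map (algebraMap R (NagataRing R)) = ⊤ ∨
      GradeDepth g n (I.map (algebraMap R (NagataRing R))) := by
  obtain rfl | hI := hI
  · exact Or.inl (Ideal.map_top _)
  · exact Or.inr (hI.map (NagataRing.map_maximalIdeal R))

end OneVariableNagata

section NagataLinks

open MvPolynomial

lemma LinkChain.map_ringHom {R B : Type*} [CommRing R] [CommRing B] [IsNoetherianRing R]
    {φ : R →+* B} (hφ : φ.Flat) {g t : ℕ} {I : Ideal R} (h : LinkChain g t I) :
    LinkChain g t (I.map φ) := by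
  algebraize [φ]
  exact h.map (B := B)

lemma LinkChain.of_map_bijective {R B : Type*} [CommRing R] [CommRing B] [IsNoetherianRing B]
    {φ : R →+* B} (hφ : Function.Bijective φ) {g t : ℕ} {I : Ideal R}
    (h : LinkChain g t (I.map φ)) : LinkChain g t I := by
  have h1 := h.map_ringHom (φ := ((RingEquiv.ofBijective φ hφ).symm : B →+* R))
    (RingHom.Flat.of_bijective (RingEquiv.ofBijective φ hφ).symm.bijective)
  rw [Ideal.map_map] at h1
  convert h1
  convert (Ideal.map_id I).symm
  ext r
  exact (RingEquiv.ofBijective φ hφ).symm_apply_apply r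

lemma map_comp_rename_C {σ τ R B : Type*} [CommRing R] [CommRing B] (φ : MvPolynomial τ R →+* B)
    (e : σ ≃ τ) :
    (φ.comp ((renameEquiv R e : MvPolynomial σ R ≃ₐ[R] _) :
      MvPolynomial σ R →+* MvPolynomial τ R)).comp C = φ.comp C := by
  ext r
  simp

theorem IsNagataExtension.linkChain_of_map {σ : Type} [Finite σ] {R B : Type} [CommRing R]
    [IsLocalRing R] [IsNoetherianRing R] [CommRing B] [Infinite (ResidueField R)]
    {φ : MvPolynomial σ R →+* B} (h : IsNagataExtension φ) {g n t : ℕ}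
    (hR : GorensteinOfDim R (g + n)) {I : Ideal R} (hI : I = ⊤ ∨ GradeDepth g n I)
    (ht : LinkChain g t (I.map (φ.comp C))) : LinkChain g t I := by
  induction σ using Finite.induction_empty_option generalizing R B with
  | @of_equiv α β e ih =>
    refine ih (h.rename e) hR hI ?_
    rwa [map_comp_rename_C]
  | h_empty =>
    have := h.isNoetherianRing
    exact LinkChain.of_map_bijective h.bijective ht
  | @h_option α _ ih =>
    obtain ⟨ψ, hψ, -, -, hψC⟩ := h.exists_option
    refine LinkChain.of_map_oneVariable (NagataRing R) hR hI (ih hψ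
      (hR.map (NagataRing.map_maximalIdeal R)) (GradeDepth.map_nagataRing hI) ?_)
    rw [Ideal.map_map, RingHom.comp_assoc]
    change LinkChain g t (I.map (ψ.comp (C.comp _)))
    rwa [hψC]

lemma fintype_induction_empty_option {P : ∀ α : Type, Fintype α → Prop}
    (of_equiv : ∀ (α β) (h : Fintype β) (e : α ≃ β), P α (Fintype.ofEquiv β e.symm) → P β h)
    (h_empty : P PEmpty inferInstance)
    (h_option : ∀ (α) (h : Fintype α), P α h → P (Option α) inferInstance)
    (α : Type) (h : Fintype α) : P α h :=
  Fintype.induction_empty_option (P := P) of_equiv h_empty h_option α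

theorem IsNagataExtension.linkChain_colon {σ : Type} [hσ : Fintype σ] {R B : Type} [CommRing R]
    [IsLocalRing R] [IsNoetherianRing R] [CommRing B]
    {φ : MvPolynomial σ R →+* B} (h : IsNagataExtension φ) {g n : ℕ}
    (hR : GorensteinOfDim R (g + n)) {I : Ideal R} (hI : GradeDepth g n I) {c : Fin g → R}
    (hc : ∀ i, c i ∈ I) (wc : WeaklyRegularMod ⊥ (List.ofFn c)) (a : σ → R) {v : σ → Fin g → R}
    (hv : ∀ k i, v k i ∈ I) {β : Fin g → B}
    (hβ : ∀ i, β i = φ (C (c i) + ∑ k, (X k - C (a k)) * C (v k i))) :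
    WeaklyRegularMod ⊥ (List.ofFn β) ∧
      ∀ t, LinkChain g t ((Ideal.span (Set.range c)).colon (I : Set R)) →
        LinkChain g t ((Ideal.span (Set.range β)).colon
          ((I.map (φ.comp C) : Ideal B) : Set B)) := by
  induction σ, hσ using fintype_induction_empty_option generalizing R B with
  | of_equiv α β' _ e ih =>
    let := Fintype.ofEquiv β' e.symm
    rw [← map_comp_rename_C φ e]
    refine ih (h.rename e) hR hI hc wc (a ∘ e) (v := v ∘ e) (fun k i => hv _ i) fun i => ?_
    rw [hβ, ← Equiv.sum_comp e]
    simp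
  | h_empty =>
    have hflat := h.flat
    algebraize [φ.comp C]
    have hβ' : algebraMap R B ∘ c = β := by
      ext i
      rw [hβ]
      simp [RingHom.algebraMap_toAlgebra]
    refine ⟨?_, fun t ht => ?_⟩
    · have := wc.map (B := B)
      rwa [Ideal.map_bot, List.map_ofFn, hβ'] at this
    · have := ht.map (B := B)
      rw [map_colon_of_flat, Ideal.map_span, ← Set.range_comp, hβ'] at this
      exact this
  | h_option α _ ih =>
    obtain ⟨ψ, hψ, hsome, hnone, hψC⟩ := h.exists_option
    have hψC' (r : R) : ψ (C (algebraMap R (NagataRing R) r)) = φ (C r) := RingHom.congr_fun hψC r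
    have hm := NagataRing.map_maximalIdeal R
    set γ : Fin g → NagataRing R := fun i => algebraMap R _ (c i) +
      algebraMap (Polynomial R) _ (Polynomial.X - Polynomial.C (a none)) *
        algebraMap R _ (v none i) with hγ
    obtain ⟨w1, h1⟩ := linkChain_colon_oneVariable (NagataRing R) hR hI hc (hv none) wc (a none)
      (β := γ) (fun i => rfl)
    have hγI : ∀ i, γ i ∈ I.map (algebraMap R (NagataRing R)) := fun i =>
      add_mem (Ideal.mem_map_of_mem _ (hc i))
        (Ideal.mul_mem_left _ _ (Ideal.mem_map_of_mem _ (hv none i)))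
    obtain ⟨w2, h2⟩ := ih hψ (hR.map hm) (hI.map hm) hγI w1
      (fun k => algebraMap R (NagataRing R) (a (some k)))
      (v := fun k i => algebraMap R (NagataRing R) (v (some k) i))
      (fun k i => Ideal.mem_map_of_mem _ (hv _ i)) (β := β) (fun i => by
        have hC : algebraMap (Polynomial R) (NagataRing R) (Polynomial.C (a none)) =
          algebraMap R (NagataRing R) (a none) :=
            (IsScalarTower.algebraMap_apply R (Polynomial R) (NagataRing R) _).symm
        rw [hβ, Fintype.sum_option]
        simp only [hγ, map_add, map_sub, map_mul, map_sum, hC, hψC', hsome]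
        rw [show ψ (C (algebraMap (Polynomial R) (NagataRing R) Polynomial.X)) = φ (X none) from
          hnone]
        ring)
    refine ⟨w2, fun t ht => ?_⟩
    have := h2 t (h1 t ht)
    rw [Ideal.map_map, RingHom.comp_assoc] at this
    rwa [← hψC]

end NagataLinks

section UniversalLink

open MvPolynomial

lemma span_range_le_genericLinkIdeal {R : Type} [CommRing R] {g m : ℕ} (f : Fin m → R)
    (I : Ideal R) (i : Fin g) :
    ∑ j : Fin m, (X (j, i) : MvPolynomial (Fin m × Fin g) R) * C (f j) ∈
      genericLinkIdeal g f I :=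
  le_colon _ _ (Ideal.subset_span ⟨i, rfl⟩)

lemma IsNagataExtension.map_genericLinkIdeal_eq_top {R B : Type} [CommRing R] [IsLocalRing R]
    [CommRing B] {g m : ℕ} (hg : 1 ≤ g) {f : Fin m → R} (hf : Ideal.span (Set.range f) = ⊤)
    {φ : MvPolynomial (Fin m × Fin g) R →+* B} (h : IsNagataExtension φ) (I : Ideal R) :
    (genericLinkIdeal g f I).map φ = ⊤ := by
  obtain ⟨j, hj⟩ : ∃ j, f j ∉ maximalIdeal R := by
    by_contra! hcon
    refine (maximalIdeal.isMaximal R).ne_top (top_le_iff.1 (hf ▸ Ideal.span_le.2 ?_))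
    rintro _ ⟨j, rfl⟩
    exact hcon j
  have hmem : ∑ j : Fin m, (X (j, ⟨0, hg⟩) : MvPolynomial (Fin m × Fin g) R) * C (f j) ∉
      (maximalIdeal R).map C := by
    intro hmem
    have := mem_map_C_iff.1 hmem (Finsupp.single (j, ⟨0, hg⟩) 1)
    rw [coeff_sum, Finset.sum_eq_single j] at this
    · rw [mul_comm, coeff_C_mul, coeff_X, if_pos rfl, mul_one] at this
      exact hj this
    · intro k _ hk
      rw [mul_comm, coeff_C_mul, coeff_X, if_neg, mul_zero]
      intro heq
      have := Finsupp.single_left_injective one_ne_zero heq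
      exact hk (Prod.ext_iff.1 this).1
    · simp
  let := φ.toAlgebra
  have h : IsLocalization ((maximalIdeal R).map
    (C : R →+* MvPolynomial (Fin m × Fin g) R)).primeCompl B := h
  exact Ideal.eq_top_of_isUnit_mem _ (Ideal.mem_map_of_mem φ
    (span_range_le_genericLinkIdeal f I ⟨0, hg⟩)) (IsLocalization.map_units
      (M := ((maximalIdeal R).map (C : R →+* MvPolynomial (Fin m × Fin g) R)).primeCompl) B
      ⟨_, hmem⟩)

lemma HasRegularSeq.exists_fin {R : Type*} [CommRing R] {I K : Ideal R} {g : ℕ}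
    (h : HasRegularSeq I K g) :
    ∃ c : Fin g → R, (∀ i, c i ∈ I) ∧ WeaklyRegularMod K (List.ofFn c) := by
  obtain ⟨xs, rfl, hx, w⟩ := h
  exact ⟨xs.get, fun i => hx _ (xs.get_mem i), by rwa [List.ofFn_get]⟩

lemma IsNagataExtension.map_genericLinkIdeal {R B : Type} [CommRing R] [IsLocalRing R]
    [IsNoetherianRing R] [CommRing B] {g m : ℕ} (f : Fin m → R)
    {φ : MvPolynomial (Fin m × Fin g) R →+* B} (h : IsNagataExtension φ) (I : Ideal R) :
    (genericLinkIdeal g f I).map φ =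
      (Ideal.span (Set.range fun i : Fin g => φ (∑ j : Fin m, X (j, i) * C (f j)))).colon
        ((I.map (φ.comp C) : Ideal B) : Set B) := by
  let := φ.toAlgebra
  have h : IsLocalization ((maximalIdeal R).map
    (C : R →+* MvPolynomial (Fin m × Fin g) R)).primeCompl B := h
  have := IsLocalization.flat B ((maximalIdeal R).map
    (C : R →+* MvPolynomial (Fin m × Fin g) R)).primeCompl
  have h1 := map_colon_of_flat (B := B) (Ideal.span (Set.range fun i : Fin g =>
    ∑ j : Fin m, (X (j, i) : MvPolynomial (Fin m × Fin g) R) * C (f j))) (I.map C)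
  rw [Ideal.map_map, Ideal.map_span, ← Set.range_comp] at h1
  exact h1

theorem IsNagataExtension.genericLink {R B : Type} [CommRing R] [IsLocalRing R]
    [IsNoetherianRing R] [Infinite (ResidueField R)] [CommRing B] [IsLocalRing B]
    {g n m : ℕ} {f : Fin m → R} {φ : MvPolynomial (Fin m × Fin g) R →+* B}
    (h : IsNagataExtension φ) (hR : GorensteinOfDim R (g + n))
    (hI : GradeDepth g n (Ideal.span (Set.range f))) :
    ((genericLinkIdeal g f (Ideal.span (Set.range f))).map φ = ⊤ ∨
      GradeDepth g n ((genericLinkIdeal g f (Ideal.span (Set.range f))).map φ)) ∧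
    ∀ t, LinkChain g t ((genericLinkIdeal g f (Ideal.span (Set.range f))).map φ) ↔
      LinkChain g (t + 1) (Ideal.span (Set.range f)) := by
  rw [h.map_genericLinkIdeal f]
  set I := Ideal.span (Set.range f) with hIdef
  set β : Fin g → B := fun i => φ (∑ j : Fin m, X (j, i) * C (f j)) with hβ
  have hβI : ∀ i, β i ∈ I.map (φ.comp C) := fun i => by
    rw [← Ideal.map_map]
    exact Ideal.mem_map_of_mem _ (sum_mem fun j _ => Ideal.mul_mem_left _ _
      (Ideal.mem_map_of_mem _ (Ideal.subset_span ⟨j, rfl⟩)))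
  have key {c : Fin g → R} (hc : ∀ i, c i ∈ I) (wc : WeaklyRegularMod ⊥ (List.ofFn c)) :
      WeaklyRegularMod ⊥ (List.ofFn β) ∧
        ∀ t, LinkChain g t ((Ideal.span (Set.range c)).colon (I : Set R)) →
          LinkChain g t ((Ideal.span (Set.range β)).colon
            ((I.map (φ.comp C) : Ideal B) : Set B)) := by
    choose A hA using fun i => (Ideal.mem_span_range_iff_exists_fun.1 (hc i))
    refine h.linkChain_colon hR hI hc wc (fun k => A k.2 k.1)
      (v := fun k i => if k.2 = i then f k.1 else 0) (fun k i => ?_) fun i => ?_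
    · split_ifs
      · exact Ideal.subset_span ⟨_, rfl⟩
      · exact zero_mem _
    · rw [hβ, Fintype.sum_prod_type, ← hA i]
      simp [sub_mul, Finset.sum_sub_distrib, apply_ite C, mul_ite]
  have hflat := h.flat
  have hN := h.isNoetherianRing
  have hm := h.map_maximalIdeal
  obtain ⟨c₀, hc₀, wc₀⟩ := hI.2.1.exists_fin
  have wβ := (key hc₀ wc₀).1
  have hB : GorensteinOfDim B (g + n) ∧ GradeDepth g n (I.map (φ.comp C)) := by
    algebraize [φ.comp C]
    exact ⟨hR.map hm, hI.map hm⟩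
  refine ⟨?_, fun t => ⟨fun ht => ?_, fun ht => ?_⟩⟩
  · have := hB.2.colon hB.1 (cs := List.ofFn β) (by simp) (by
      intro y hy
      obtain ⟨i, rfl⟩ := (List.mem_ofFn' _ y).1 hy
      exact hβI i) wβ
    rwa [ofList_ofFn] at this
  · exact h.linkChain_of_map hR (Or.inr hI) (Or.inr ⟨β, hβI, wβ, ht⟩)
  · obtain ht | ⟨c, hc, wc, ht⟩ := ht
    · exact absurd ht hI.1
    · exact (key hc wc).2 t ht

lemma isLocalizationHom_algebraMap {T B : Type*} [CommRing T] [CommRing B] [Algebra T B]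
    (Q : Ideal T) [Q.IsPrime] [h : IsLocalization.AtPrime B Q] :
    IsLocalizationHom (algebraMap T B) Q := by
  have heq : (algebraMap T B).toAlgebra = ‹Algebra T B› := Algebra.algebra_ext _ _ fun r => rfl
  unfold IsLocalizationHom
  rw [heq]
  exact h

theorem IsNagataExtension.genericLink_of_eq {R B : Type} [CommRing R] [IsLocalRing R]
    [IsNoetherianRing R] [Infinite (ResidueField R)] [CommRing B] [IsLocalRing B]
    {g g' n m : ℕ} (hg : g' = g) {f : Fin m → R} {L : Ideal R} (hf : Ideal.span (Set.range f) = L)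
    {φ : MvPolynomial (Fin m × Fin g') R →+* B}
    (h : IsNagataExtension φ) (hR : GorensteinOfDim R (g + n)) (hI : GradeDepth g n L) :
    ((genericLinkIdeal g' f L).map φ = ⊤ ∨ GradeDepth g n ((genericLinkIdeal g' f L).map φ)) ∧
    ∀ t, LinkChain g t ((genericLinkIdeal g' f L).map φ) ↔ LinkChain g (t + 1) L := by
  subst hg hf
  exact h.genericLink hR hI

/-- An iterated universal link is the unit ideal or Cohen-Macaulay of the same grade, and its chains
of links to the unit ideal correspond to those of the original ideal. -/
theorem IsUniversalLinkOf.linkChain_iff {R : Type} [CommRing R] [IsLocalRing R]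
    [IsNoetherianRing R] [Infinite (ResidueField R)] {g n e : ℕ} (hg : 1 ≤ g)
    (hR : GorensteinOfDim R (g + n)) {I : Ideal R} (hI : GradeDepth g n I)
    {B : CommRingCat.{0}} {φ : R →+* B} {L : Ideal B} (h : IsUniversalLinkOf R e I B φ L) :
    ∃ _ : IsLocalRing B, IsNoetherianRing B ∧ Infinite (ResidueField B) ∧
      GorensteinOfDim B (g + n) ∧ (L = ⊤ ∨ GradeDepth g n L) ∧
      ∀ t, LinkChain g t L ↔ LinkChain g (t + e) I := by
  induction h with
  | zero I =>
    exact ⟨‹IsLocalRing R›, ‹IsNoetherianRing R›, ‹Infinite (ResidueField R)›, hR, Or.inr hI,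
      fun t => Iff.rfl⟩
  | @succ e I B φ L h hB m f hf hQ ih =>
    obtain ⟨_, hN, hinf, hGB, hL, hchain⟩ := ih hI
    set Q := (maximalIdeal B).map
      (C : B →+* MvPolynomial (Fin m × Fin (gradeOf B L)) B) with hQdef
    have hφ : IsNagataExtension (algebraMap (MvPolynomial (Fin m × Fin (gradeOf B L)) B)
        (Localization.AtPrime Q)) :=
      isLocalizationHom_algebraMap Q
    have hflat := hφ.flat
    have hm := hφ.map_maximalIdeal
    have hGB' : GorensteinOfDim (Localization.AtPrime Q) (g + n) := by
      algebraize [(algebraMap (MvPolynomial (Fin m × Fin (gradeOf B L)) B)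
        (Localization.AtPrime Q)).comp C]
      exact hGB.map hm
    refine ⟨(inferInstance : IsLocalRing (Localization.AtPrime Q)), hφ.isNoetherianRing,
      infinite_residueField _ hm.le, hGB', ?_⟩
    obtain rfl | hL := hL
    · have hgr : 1 ≤ gradeOf B ⊤ := by
        rw [hGB.gradeOf_top]
        omega
      have htop := hφ.map_genericLinkIdeal_eq_top hgr hf ⊤
      refine ⟨Or.inl htop, fun t => iff_of_true ?_ ?_⟩
      · convert LinkChain.top g t
      · have := (hchain (t + 1)).1 (LinkChain.top _ _)
        rwa [add_right_comm] at this
    · obtain ⟨h1, h2⟩ := hφ.genericLink_of_eq (hL.gradeOf_eq hGB) hf hGB hL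
      refine ⟨h1, fun t => (h2 t).trans ((hchain (t + 1)).trans ?_)⟩
      rw [add_right_comm, add_assoc]

end UniversalLink

/-- Proposition 2.3(a). Let `I` be a Cohen-Macaulay ideal of positive
grade in a Noetherian local Gorenstein ring with infinite residue field, and `e ≥ 1`.
Then the `e`-th universal link `L^e(I)` is the unit ideal if and only if `I` can be
linked to a complete intersection in `e-1` steps. -/
theorem statement1 (R : Type) [CommRing R] [IsLocalRing R] [IsNoetherianRing R]
    (hGor : IsGorensteinLocalRing R) (hres : Infinite (IsLocalRing.ResidueField R))
    (I : Ideal R) (hCM : IsCMIdeal R I) (hgrade : ∃ r ∈ I, r ∈ nonZeroDivisors R)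
    (e : ℕ) (he : 1 ≤ e) :
    ∀ (B : CommRingCat.{0}) (φ : R →+* B) (L : Ideal B),
      IsUniversalLinkOf R e I B φ L →
        (L = ⊤ ↔ ∃ J : Ideal R, LinkedInSteps R (e - 1) I J ∧
          IsCompleteIntersectionIdeal R J) := by
  intro B φ L h
  obtain ⟨d, hd⟩ := gorensteinOfDim_of_isGorensteinLocalRing hGor
  obtain ⟨g, n, rfl, hg, hI⟩ := GradeDepth.of_isCMIdeal hd hCM hgrade
  obtain ⟨_, _, _, _, _, hchain⟩ := h.linkChain_iff hg hd hI
  obtain ⟨e, rfl⟩ : ∃ e', e = e' + 1 := ⟨e - 1, by omega⟩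
  have h0 := hchain 0
  rw [zero_add] at h0
  exact ⟨fun hL => exists_linkedInSteps_of_linkChain hd hg e hI (h0.1 hL),
    fun ⟨_, hJ, hci⟩ => h0.2 (linkChain_of_linkedInSteps hd e hI hJ hci)⟩
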